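/- arXiv:math/0510093 — 4 statements merged into one kernel-verified Lean document; each statement's English description precedes it below -/
import Mathlib

section
/- Let p, n be natural numbers with 2 ≤ p ≤ n−2. For every ω ∈ ⋀^p k^n, the following four conditions are equivalent: (1) ω is decomposable; (2) ⋀^p X(ω) ∈ ⋀^p Q^{p+2} is decomposable over Q; (3) G(ω) ∈ ⋀^2 Q^4 is decomposable over Q; (4) H(ω) = 0 in Q. -/
open ExteriorAlgebra

noncomputable section

variable (k : Type*) [Field k]

/-- The alternating map giving the coordinate `Π_idx` (antisymmetric in `idx`). -/
def coordA {n : ℕ} (q : ℕ) (idx : Fin q → Fin n) :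
    (Fin n → k) [⋀^Fin q]→ₗ[k] k :=
  (Matrix.detRowAlternating : (Fin q → k) [⋀^Fin q]→ₗ[k] k).compLinearMap
    (LinearMap.funLeft k k idx)

/-- The coordinate functional `Π_idx` on the exterior algebra. -/
def coordF {n : ℕ} (q : ℕ) (idx : Fin q → Fin n) :
    ExteriorAlgebra k (Fin n → k) →ₗ[k] k :=
  ExteriorAlgebra.liftAlternating
    (Function.update (fun i => (0 : (Fin n → k) [⋀^Fin i]→ₗ[k] k)) q (coordA k q idx))

/-- Decomposability of an element of the exterior algebra, in degree `q`. -/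
def IsDecomp {n : ℕ} (q : ℕ) (x : ExteriorAlgebra k (Fin n → k)) : Prop :=
  ∃ v : Fin q → (Fin n → k), x = ExteriorAlgebra.ιMulti k q v

/-- The dual isomorphism `δ` on the degree-`p` part, with values in degree `n-p`. -/
def dualAt (n p : ℕ) (ω : ExteriorAlgebra k (Fin n → k)) :
    ExteriorAlgebra k (Fin n → k) :=
  ∑ s : {s : Finset (Fin n) // s.card = p},
    coordF k p (fun a => (s.1.orderIsoOfFin s.2 a : Fin n)) ω •
      ExteriorAlgebra.ιMulti k (n - p)
        (fun a => Pi.single (((s.1ᶜ).orderIsoOfFin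
          (by rw [Finset.card_compl, s.2, Fintype.card_fin]) a : Fin n)) (1 : k))

/-- The index tuple `(α_i, α_j, β_1^{ε_1}, …, β_m^{ε_m}, γ_1, …, γ_c)`. -/
def tupleP {n : ℕ} (m c : ℕ) (α : Fin 4 → Fin n) (β : Fin m → Fin 2 → Fin n)
    (γ : Fin c → Fin n) (i j : Fin 4) (ε : Fin m → Fin 2) : Fin (2 + (m + c)) → Fin n :=
  Fin.append ![α i, α j] (Fin.append (fun l => β l (ε l)) γ)

/-- The functional `π_{ij} = Π_{α_i α_j β⃗_1 … β⃗_m γ_1 … γ_c}`. -/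
def piF {n : ℕ} (m c : ℕ) (α : Fin 4 → Fin n) (β : Fin m → Fin 2 → Fin n)
    (γ : Fin c → Fin n) (i j : Fin 4) :
    ExteriorAlgebra k (Fin n → k) →ₗ[k] k :=
  ∑ ε : Fin m → Fin 2, coordF k (2 + (m + c)) (tupleP m c α β γ i j ε)

/-- The rank 6 quadratic form `P'_{A,B,C}`. -/
def Pprime {n : ℕ} (m c : ℕ) (α : Fin 4 → Fin n) (β : Fin m → Fin 2 → Fin n)
    (γ : Fin c → Fin n) (ω : ExteriorAlgebra k (Fin n → k)) : k :=
  piF k m c α β γ 0 1 ω * piF k m c α β γ 2 3 ω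
    - piF k m c α β γ 0 2 ω * piF k m c α β γ 1 3 ω
    + piF k m c α β γ 0 3 ω * piF k m c α β γ 1 2 ω

/-- The ordering/distinctness conditions on the triple `(A,B,C)`. -/
def OrderedABC {n : ℕ} (m c : ℕ) (α : Fin 4 → Fin n) (β : Fin m → Fin 2 → Fin n)
    (γ : Fin c → Fin n) : Prop :=
  Function.Injective (Sum.elim α (Sum.elim (fun x : Fin m × Fin 2 => β x.1 x.2) γ)) ∧
    StrictMono α ∧ (∀ l, β l 0 < β l 1) ∧
    (∀ ν : Fin 2, StrictMono fun l => β l ν) ∧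
    (∀ l, β l 0 < α 0) ∧ (∀ l, β l 1 < α 2) ∧ StrictMono γ

/-- The set `S' = A ∪ B_1 ∪ C`. -/
def SP {n : ℕ} (m c : ℕ) (α : Fin 4 → Fin n) (β : Fin m → Fin 2 → Fin n)
    (γ : Fin c → Fin n) : Finset (Fin n) :=
  Finset.univ.image α ∪ Finset.univ.image (fun l => β l 1) ∪ Finset.univ.image γ

open Classical in
/-- The matrix of the map `X_{A,B,C} : k^n → k^{p+2}`. -/
def Xmat (p : ℕ) {n : ℕ} (m c : ℕ) (α : Fin 4 → Fin n) (β : Fin m → Fin 2 → Fin n)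
    (γ : Fin c → Fin n) : Matrix (Fin (p + 2)) (Fin n) k :=
  if h : (SP m c α β γ).card = p + 2 then
    fun j i =>
      (if i = ((SP m c α β γ).orderIsoOfFin h j : Fin n) then 1 else 0) +
        ∑ l : Fin m,
          if i = β l 0 ∧ β l 1 = ((SP m c α β γ).orderIsoOfFin h j : Fin n) then 1 else 0
  else 0

/-- The linear map `X_{A,B,C} : k^n → k^{p+2}`. -/
def XL (p : ℕ) {n : ℕ} (m c : ℕ) (α : Fin 4 → Fin n) (β : Fin m → Fin 2 → Fin n)
    (γ : Fin c → Fin n) : (Fin n → k) →ₗ[k] (Fin (p + 2) → k) :=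
  (Xmat k p m c α β γ).mulVecLin

open Classical in
/-- The matrix of the map `Z : k^{p+2} → k^4`. -/
def Zmat (p : ℕ) {n : ℕ} (m c : ℕ) (α : Fin 4 → Fin n) (β : Fin m → Fin 2 → Fin n)
    (γ : Fin c → Fin n) : Matrix (Fin 4) (Fin (p + 2)) k :=
  fun j i => if XL k p m c α β γ (Pi.single (α j) 1) = Pi.single i 1 then 1 else 0

/-- The linear map `Z : k^{p+2} → k^4`. -/
def ZL (p : ℕ) {n : ℕ} (m c : ℕ) (α : Fin 4 → Fin n) (β : Fin m → Fin 2 → Fin n)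
    (γ : Fin c → Fin n) : (Fin (p + 2) → k) →ₗ[k] (Fin 4 → k) :=
  (Zmat k p m c α β γ).mulVecLin

/-- The Grassmann cone preserving map `G_{A,B,C} = ⋀²Z ∘ δ ∘ ⋀^p X_{A,B,C}`. -/
def GABC (p : ℕ) {n : ℕ} (m c : ℕ) (α : Fin 4 → Fin n) (β : Fin m → Fin 2 → Fin n)
    (γ : Fin c → Fin n) (ω : ExteriorAlgebra k (Fin n → k)) :
    ExteriorAlgebra k (Fin 4 → k) :=
  ExteriorAlgebra.map (ZL k p m c α β γ)
    (dualAt k (p + 2) p (ExteriorAlgebra.map (XL k p m c α β γ) ω))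

/-- The general Plücker quadratic form `P_{A,B}` for index sequences
`a : Fin d → Fin n` and `b : Fin (e+1) → Fin n`. -/
def Pluecker {n : ℕ} (d e : ℕ) (a : Fin d → Fin n) (b : Fin (e + 1) → Fin n)
    (ω : ExteriorAlgebra k (Fin n → k)) : k :=
  ∑ i : Fin (e + 1), (-1 : k) ^ (i : ℕ) *
    (coordF k (d + 1) (Fin.snoc a (b i)) ω * coordF k e (fun j => b (i.succAbove j)) ω)


/-- Base change of an element of the exterior algebra along a ring homomorphism
`f : k →+* F`, defined through the coordinates in degree `p`. -/
def baseChangeHom {n : ℕ} (F : Type*) [Field F] (f : k →+* F) (p : ℕ)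
    (ω : ExteriorAlgebra k (Fin n → k)) : ExteriorAlgebra F (Fin n → F) :=
  ∑ s : {s : Finset (Fin n) // s.card = p},
    f (coordF k p (fun a => (s.1.orderIsoOfFin s.2 a : Fin n)) ω) •
      ExteriorAlgebra.ιMulti F p
        (fun a => Pi.single ((s.1.orderIsoOfFin s.2 a : Fin n)) (1 : F))

/-- The linear map `F^n → F^{p+2}` whose matrix has `(i,j)` entry `x_i^{j-1}`. -/
def vandL (F : Type*) [Field F] (p n : ℕ) (x : Fin (p + 2) → F) :
    (Fin n → F) →ₗ[F] (Fin (p + 2) → F) :=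
  (Matrix.of fun i (j : Fin n) => x i ^ (j : ℕ)).mulVecLin

end

noncomputable section

variable (k : Type*) [Field k] (p n : ℕ)

/-- `Q`, the field of fractions of `R = k[x_1, …, x_{p+2}]`. -/
abbrev Qf : Type _ := FractionRing (MvPolynomial (Fin (p + 2)) k)

/-- The canonical ring homomorphism `k → Q`. -/
def kToQ : k →+* Qf k p :=
  (algebraMap (MvPolynomial (Fin (p + 2)) k) (Qf k p)).comp
    (algebraMap k (MvPolynomial (Fin (p + 2)) k))

/-- The parameters `x_1, …, x_{p+2}` as elements of `Q`. -/
def xvar (i : Fin (p + 2)) : Qf k p :=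
  algebraMap (MvPolynomial (Fin (p + 2)) k) (Qf k p) (MvPolynomial.X i)

/-- The `Q`-linear map `X : Q^n → Q^{p+2}` with matrix entries `x_i^{j-1}`. -/
def XQ : (Fin n → Qf k p) →ₗ[Qf k p] (Fin (p + 2) → Qf k p) :=
  vandL (Qf k p) p n (xvar k p)

/-- The image `⋀^p X(ω) ∈ ⋀^p Q^{p+2}` of `ω ∈ ⋀^p k^n`. -/
def XQω (ω : ExteriorAlgebra k (Fin n → k)) :
    ExteriorAlgebra (Qf k p) (Fin (p + 2) → Qf k p) :=
  ExteriorAlgebra.map (XQ k p n) (baseChangeHom k (Qf k p) (kToQ k p) p ω)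

/-- The projection `Z = (I O) : Q^{p+2} → Q^4` onto the first four coordinates. -/
def ZQ : (Fin (p + 2) → Qf k p) →ₗ[Qf k p] (Fin 4 → Qf k p) :=
  (Matrix.of fun (i : Fin 4) (j : Fin (p + 2)) =>
    if (j : ℕ) = (i : ℕ) then (1 : Qf k p) else 0).mulVecLin

/-- The parameter-dependent GCP map `G = ⋀²Z ∘ δ ∘ ⋀^p X : ⋀^p k^n → ⋀² Q⁴`. -/
def GQ (ω : ExteriorAlgebra k (Fin n → k)) :
    ExteriorAlgebra (Qf k p) (Fin 4 → Qf k p) :=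
  ExteriorAlgebra.map (ZQ k p) (dualAt (Qf k p) (p + 2) p (XQω k p n ω))

/-- The parameter-dependent rank 6 quadratic expression
`H(ω) = Π̂₁₂Π̂₃₄ − Π̂₁₃Π̂₂₄ + Π̂₁₄Π̂₂₃ ∈ Q`. -/
def HQ (ω : ExteriorAlgebra k (Fin n → k)) : Qf k p :=
  coordF (Qf k p) 2 ![0, 1] (GQ k p n ω) * coordF (Qf k p) 2 ![2, 3] (GQ k p n ω)
    - coordF (Qf k p) 2 ![0, 2] (GQ k p n ω) * coordF (Qf k p) 2 ![1, 3] (GQ k p n ω)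
    + coordF (Qf k p) 2 ![0, 3] (GQ k p n ω) * coordF (Qf k p) 2 ![1, 2] (GQ k p n ω)

end

namespace AlternatingMap

section Ring

variable {R M N : Type*} [CommRing R] [AddCommGroup M] [Module R M] [AddCommGroup N] [Module R N]

theorem map_vecCons_swap {q : ℕ} (f : M [⋀^Fin (q + 2)]→ₗ[R] N) (a b : M) (v : Fin q → M) :
    f (Matrix.vecCons a (Matrix.vecCons b v)) = -f (Matrix.vecCons b (Matrix.vecCons a v)) := by
  rw [← f.map_swap _ (show (0 : Fin (q + 2)) ≠ 1 by simp)]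
  congr 1
  funext i
  refine Fin.cases ?_ (fun i => Fin.cases ?_ (fun i => ?_) i) i
  · simp
  · rw [Fin.succ_zero_eq_one]
    simp
  · rw [Function.comp_apply, Equiv.swap_apply_of_ne_of_ne]
    · simp
    · simp [Fin.ext_iff]
    · simp [Fin.ext_iff]

theorem map_vecCons_rotate {q : ℕ} (f : M [⋀^Fin (q + 3)]→ₗ[R] N) (a b c : M)
    (v : Fin q → M) :
    f (Matrix.vecCons a (Matrix.vecCons b (Matrix.vecCons c v))) =
      f (Matrix.vecCons c (Matrix.vecCons a (Matrix.vecCons b v))) := by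
  have h := (f.curryLeft a).map_vecCons_swap b c v
  simp only [curryLeft_apply_apply] at h
  rw [h, f.map_vecCons_swap c a]

theorem map_eq_zero_of_curryLeft {q : ℕ} (f : M [⋀^Fin (q + 1)]→ₗ[R] N) {v : Fin (q + 1) → M}
    (i : Fin (q + 1)) (h : f.curryLeft (v i) (i.removeNth v) = 0) : f v = 0 := by
  rw [← Fin.insertNth_self_removeNth i v, f.map_insertNth]
  rw [curryLeft_apply_apply] at h
  rw [h, smul_zero]

theorem map_eq_zero_of_curryLeft_eq_zero {q : ℕ} (f : M [⋀^Fin (q + 1)]→ₗ[R] N)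
    {v : Fin (q + 1) → M} (i : Fin (q + 1)) (h : f.curryLeft (v i) = 0) : f v = 0 :=
  f.map_eq_zero_of_curryLeft i (by simp [h])

theorem map_eq_zero_of_curryLeft_curryLeft {q : ℕ} (f : M [⋀^Fin (q + 2)]→ₗ[R] N)
    {v : Fin (q + 2) → M} {i j : Fin (q + 2)} (hij : i ≠ j)
    (h : (f.curryLeft (v i)).curryLeft (v j) = 0) : f v = 0 := by
  obtain ⟨l, rfl⟩ := Fin.exists_succAbove_eq hij.symm
  exact f.map_eq_zero_of_curryLeft i ((f.curryLeft (v i)).map_eq_zero_of_curryLeft_eq_zero l h)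

theorem map_add_of_curryLeft_eq_zero {q : ℕ} (f : M [⋀^Fin (q + 1)]→ₗ[R] N)
    (v w : Fin (q + 1) → M) (h : ∀ i, f.curryLeft (w i) = 0) : f (v + w) = f v := by
  have key := f.toMultilinearMap.map_add_univ v w
  rw [Finset.sum_eq_single Finset.univ] at key
  · simpa using key
  · intro s _ hs
    obtain ⟨i, hi⟩ : ∃ i, i ∉ s := by
      by_contra! hc
      exact hs (Finset.eq_univ_iff_forall.2 hc)
    refine f.map_eq_zero_of_curryLeft_eq_zero i ?_
    rw [Finset.piecewise_eq_of_notMem _ _ _ hi, h]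
  · simp

end Ring

section Field

variable {K M : Type*} [Field K] [AddCommGroup M] [Module K M]

/-- An alternating form is totally decomposable when it is a multiple of a wedge product of
linear forms. -/
def IsDecomposable {q : ℕ} (f : M [⋀^Fin q]→ₗ[K] K) : Prop :=
  ∃ (c : K) (g : Fin q → M →ₗ[K] K), ∀ x, f x = c * (Matrix.of fun i j => g i (x j)).det

theorem isDecomposable_zero {q : ℕ} : (0 : M [⋀^Fin q]→ₗ[K] K).IsDecomposable :=
  ⟨0, 0, fun x => by simp⟩

theorem IsDecomposable.curryLeft_eq_zero {q : ℕ} {f : M [⋀^Fin (q + 1)]→ₗ[K] K}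
    (hf : f.IsDecomposable) {a : Fin (q + 1) → M} (ha : f a ≠ 0) {x : M}
    (hx : ∀ i, f (Function.update a i x) = 0) : f.curryLeft x = 0 := by
  obtain ⟨c, g, hg⟩ := hf
  have hc : c ≠ 0 := by
    rintro rfl
    simp [hg] at ha
  set B : Matrix (Fin (q + 1)) (Fin (q + 1)) K := Matrix.of fun i j => g i (a j) with hB
  have hdet : B.det ≠ 0 := by
    intro h
    rw [hg, ← hB, h, mul_zero] at ha
    exact ha rfl
  have hcramer : B.cramer (fun i => g i x) = 0 := by
    funext i
    have h := hx i
    rw [hg] at h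
    rw [Matrix.cramer_apply, Pi.zero_apply, ← (mul_eq_zero.1 h).resolve_left hc]
    congr 1
    ext l m
    rw [Matrix.updateCol_apply, Matrix.of_apply, Function.update_apply]
    split_ifs <;> rfl
  have hgx : (fun i => g i x) = 0 := by
    have h := B.mulVec_cramer (fun i => g i x)
    rw [hcramer, Matrix.mulVec_zero] at h
    exact (smul_eq_zero.1 h.symm).resolve_left hdet
  ext v
  rw [curryLeft_apply_apply, hg, Matrix.det_eq_zero_of_column_eq_zero 0, mul_zero]
  · rfl
  · intro i
    exact congrFun hgx i

theorem eq_mul_det_of_curryLeft_eq_zero {q : ℕ} {f : M [⋀^Fin (q + 1)]→ₗ[K] K}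
    {a : Fin (q + 1) → M} (ha : f a ≠ 0)
    (h : ∀ x, (∀ i, f (Function.update a i x) = 0) → f.curryLeft x = 0) (x : Fin (q + 1) → M) :
    f x = f a * (Matrix.of fun i j => (f a)⁻¹ * f (Function.update a i (x j))).det := by
  set g : Fin (q + 1) → M →ₗ[K] K := fun i => (f a)⁻¹ • f.toMultilinearMap.toLinearMap a i with hg
  have hgx : ∀ i y, g i y = (f a)⁻¹ * f (Function.update a i y) := fun i y => rfl
  have hga : ∀ i j, g i (a j) = if i = j then 1 else 0 := by
    intro i j
    rw [hgx]
    split_ifs with hij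
    · subst hij
      rw [Function.update_eq_self, inv_mul_cancel₀ ha]
    · rw [f.map_update_self _ hij, mul_zero]
  set L : (Fin (q + 1) → K) →ₗ[K] M := Fintype.linearCombination K a with hL
  have h1 : f x = f (fun j => L fun i => g i (x j)) := by
    rw [← f.map_add_of_curryLeft_eq_zero (fun j => L fun i => g i (x j))
      (fun j => x j - L fun i => g i (x j))]
    · congr 1
      funext j
      simp
    · intro j
      refine h _ fun i => ?_
      have h2 : g i (x j - L fun i => g i (x j)) = 0 := by
        rw [map_sub, hL, Fintype.linearCombination_apply, map_sum]
        simp [hga]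
      rw [hgx] at h2
      exact (mul_eq_zero.1 h2).resolve_left (inv_ne_zero ha)
  have h2 := (f.compLinearMap L).eq_smul_basis_det (Pi.basisFun K (Fin (q + 1)))
  have h3 := congrArg (fun F => F fun j i => g i (x j)) h2
  simp only [compLinearMap_apply, smul_apply, Pi.basisFun_det_apply] at h3
  rw [h1]
  refine h3.trans ?_
  rw [smul_eq_mul, ← Matrix.det_transpose]
  congr 2
  funext j
  simp [hL, Fintype.linearCombination_apply, Pi.single_apply]

theorem isDecomposable_of_curryLeft_eq_zero {q : ℕ} {f : M [⋀^Fin (q + 1)]→ₗ[K] K}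
    {a : Fin (q + 1) → M} (ha : f a ≠ 0)
    (h : ∀ x, (∀ i, f (Function.update a i x) = 0) → f.curryLeft x = 0) : f.IsDecomposable :=
  ⟨f a, fun i => (f a)⁻¹ • f.toMultilinearMap.toLinearMap a i,
    eq_mul_det_of_curryLeft_eq_zero ha h⟩

theorem IsDecomposable.curryLeft {q : ℕ} {f : M [⋀^Fin (q + 2)]→ₗ[K] K}
    (hf : f.IsDecomposable) (c : M) : (f.curryLeft c).IsDecomposable := by
  by_cases h0 : f.curryLeft c = 0
  · rw [h0]
    exact isDecomposable_zero
  obtain ⟨w, hw⟩ : ∃ w, f.curryLeft c w ≠ 0 := by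
    by_contra! hc
    exact h0 (AlternatingMap.ext hc)
  refine isDecomposable_of_curryLeft_eq_zero hw fun x hx => ?_
  rw [curryLeft_apply_apply] at hw
  have key : f.curryLeft (x - (f (Matrix.vecCons x w) / f (Matrix.vecCons c w)) • c) = 0 := by
    refine hf.curryLeft_eq_zero hw fun i => ?_
    rw [f.map_update_sub, f.map_update_smul]
    refine Fin.cases ?_ (fun i => ?_) i
    · have h1 : ∀ y, Function.update (Matrix.vecCons c w) 0 y = Matrix.vecCons y w :=
        fun y => Fin.update_cons_zero _ _ _
      rw [h1, h1, smul_eq_mul, div_mul_cancel₀ _ hw, sub_self]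
    · have h1 : ∀ y, Function.update (Matrix.vecCons c w) i.succ y =
          Matrix.vecCons c (Function.update w i y) := fun y => (Fin.cons_update _ _ _ _).symm
      rw [h1, h1, ← curryLeft_apply_apply, hx, zero_sub, neg_eq_zero, smul_eq_zero]
      right
      exact f.map_eq_zero_of_eq _ (i := 0) (j := i.succ) (by simp) (Fin.succ_ne_zero i).symm
  rw [map_sub, map_smul, sub_eq_zero] at key
  ext v
  rw [curryLeft_apply_apply, curryLeft_apply_apply, map_vecCons_swap, ← curryLeft_apply_apply, key]
  rw [smul_apply, curryLeft_apply_apply, f.map_eq_zero_of_eq (Matrix.vecCons c (Matrix.vecCons c v))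
    (i := 0) (j := 1) (by simp) (by simp), smul_zero, neg_zero, zero_apply]

/-- The three-term Plücker expression of an alternating form, in the four vectors `a b c d` with
the remaining arguments `u` fixed. -/
def threeTerm {q : ℕ} (f : M [⋀^Fin (q + 2)]→ₗ[K] K) (u : Fin q → M) (a b c d : M) : K :=
  f (Matrix.vecCons a (Matrix.vecCons b u)) * f (Matrix.vecCons c (Matrix.vecCons d u))
    - f (Matrix.vecCons a (Matrix.vecCons c u)) * f (Matrix.vecCons b (Matrix.vecCons d u))
    + f (Matrix.vecCons a (Matrix.vecCons d u)) * f (Matrix.vecCons b (Matrix.vecCons c u))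

theorem threeTerm_vecCons {q : ℕ} (f : M [⋀^Fin (q + 3)]→ₗ[K] K) (e : M) (u : Fin q → M)
    (a b c d : M) :
    f.threeTerm (Matrix.vecCons e u) a b c d = (f.curryLeft e).threeTerm u a b c d := by
  simp only [threeTerm, f.map_vecCons_rotate _ _ e, curryLeft_apply_apply]

theorem IsDecomposable.threeTerm_eq_zero {q : ℕ} {f : M [⋀^Fin (q + 2)]→ₗ[K] K}
    (hf : f.IsDecomposable) (u : Fin q → M) (a b c d : M) : f.threeTerm u a b c d = 0 := by
  induction q with
  | zero =>
    obtain ⟨e, g, hg⟩ := hf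
    have hg' : ∀ x, f x = e * (g 0 (x 0) * g 1 (x 1) - g 0 (x 1) * g 1 (x 0)) := fun x =>
      (hg x).trans (congrArg (e * ·) (Matrix.det_fin_two _))
    simp only [threeTerm, hg', Matrix.cons_val_zero, Matrix.cons_val_one]
    ring
  | succ q ih =>
    rw [← Matrix.cons_head_tail u, threeTerm_vecCons]
    exact ih (hf.curryLeft _) _

theorem isDecomposable_of_threeTerm_eq_zero {f : M [⋀^Fin 2]→ₗ[K] K}
    (h : ∀ a b c d, f.threeTerm ![] a b c d = 0) : f.IsDecomposable := by
  by_cases h0 : f = 0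
  · rw [h0]
    exact isDecomposable_zero
  obtain ⟨a, ha⟩ : ∃ a, f a ≠ 0 := by
    by_contra! hc
    exact h0 (AlternatingMap.ext hc)
  refine isDecomposable_of_curryLeft_eq_zero ha fun x hx => ?_
  ext v
  have e : ∀ v : Fin 2 → M, v = ![v 0, v 1] := fun v => by
    ext i; fin_cases i <;> rfl
  have e1 : v = ![v 0] := by
    ext i; fin_cases i; rfl
  have hx0 : f ![x, a 1] = 0 := by
    have := hx 0
    rw [e (Function.update _ _ _)] at this
    simpa using this
  have hx1 : f ![a 0, x] = 0 := by
    have := hx 1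
    rw [e (Function.update _ _ _)] at this
    simpa using this
  rw [e a] at ha
  have key := h (a 0) (a 1) x (v 0)
  rw [threeTerm, hx1, f.map_vecCons_swap (a 1) x, hx0] at key
  rw [curryLeft_apply_apply, e1]
  simpa [ha] using key

end Field

end AlternatingMap

section MomentCurve

variable {K : Type*} {n : ℕ}

/-- The point `(1, t, t², …)` of the moment curve. -/
def momentCurve [Monoid K] (n : ℕ) (t : K) : Fin n → K := fun j => t ^ (j : ℕ)

variable [Field K]

theorem eq_zero_or_eq_zero_of_momentCurve [Infinite K] {l₁ l₂ : (Fin n → K) →ₗ[K] K}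
    (h : ∀ t, l₁ (momentCurve n t) * l₂ (momentCurve n t) = 0) : l₁ = 0 ∨ l₂ = 0 := by
  set P : ((Fin n → K) →ₗ[K] K) → Polynomial K := fun l =>
    ∑ j : Fin n, Polynomial.C (l (Pi.single j 1)) * Polynomial.X ^ (j : ℕ) with hP
  have heval : ∀ l t, (P l).eval t = l (momentCurve n t) := by
    intro l t
    conv_rhs => rw [pi_eq_sum_univ' (momentCurve n t), map_sum]
    rw [hP, Polynomial.eval_finsetSum]
    refine Finset.sum_congr rfl fun j _ => ?_
    rw [Polynomial.eval_mul, Polynomial.eval_C, Polynomial.eval_pow, Polynomial.eval_X, map_smul,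
      smul_eq_mul, mul_comm]
    rfl
  have hzero : ∀ l, P l = 0 → l = 0 := by
    intro l hl
    refine LinearMap.pi_ext' fun j => LinearMap.ext_ring ?_
    have hc := congrArg (fun p => Polynomial.coeff p (j : ℕ)) hl
    simpa [hP, Polynomial.finsetSum_coeff, Polynomial.coeff_X_pow, Fin.val_inj] using hc
  have hmul : P l₁ * P l₂ = 0 := Polynomial.funext fun t => by
    rw [Polynomial.eval_mul, heval, heval, h, Polynomial.eval_zero]
  exact (mul_eq_zero.1 hmul).imp (hzero _) (hzero _)

theorem eq_zero_of_momentCurve [Infinite K] {l : (Fin n → K) →ₗ[K] K}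
    (h : ∀ t, l (momentCurve n t) = 0) : l = 0 :=
  (eq_zero_or_eq_zero_of_momentCurve (l₁ := l) (l₂ := l) fun t => by rw [h, zero_mul]).elim id id

namespace AlternatingMap

/-- The linear form obtained from an alternating form by fixing all arguments but the first. -/
def headForm {M : Type*} [AddCommGroup M] [Module K M] {q : ℕ} (f : M [⋀^Fin (q + 1)]→ₗ[K] K)
    (v : Fin q → M) : M →ₗ[K] K where
  toFun x := f (Matrix.vecCons x v)
  map_add' := f.map_vecCons_add v
  map_smul' := f.map_vecCons_smul v

theorem headForm_apply {M : Type*} [AddCommGroup M] [Module K M] {q : ℕ}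
    (f : M [⋀^Fin (q + 1)]→ₗ[K] K) (v : Fin q → M) (x : M) :
    f.headForm v x = f (Matrix.vecCons x v) := rfl

theorem threeTerm_rotate {M : Type*} [AddCommGroup M] [Module K M] {q : ℕ}
    (f : M [⋀^Fin (q + 2)]→ₗ[K] K) (u : Fin q → M) (a b c d : M) :
    f.threeTerm u b c d a = -f.threeTerm u a b c d := by
  simp only [threeTerm]
  rw [f.map_vecCons_swap d a, f.map_vecCons_swap c a, f.map_vecCons_swap b a]
  ring

variable [Infinite K]

theorem eq_zero_of_curryLeft_momentCurve {q : ℕ} {f : (Fin n → K) [⋀^Fin (q + 1)]→ₗ[K] K}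
    (h : ∀ t, f.curryLeft (momentCurve n t) = 0) : f = 0 := by
  ext v
  have hl : f.headForm (Matrix.vecTail v) = 0 := eq_zero_of_momentCurve fun t => by
    rw [headForm_apply, ← curryLeft_apply_apply, h, zero_apply]
  rw [← Matrix.cons_head_tail v, ← headForm_apply, hl]
  rfl

theorem threeTerm_eq_zero_of_momentCurve {q : ℕ} {f : (Fin n → K) [⋀^Fin (q + 2)]→ₗ[K] K}
    {u : Fin q → Fin n → K} {b c d : Fin n → K}
    (h : ∀ t, f.threeTerm u (momentCurve n t) b c d = 0) (a : Fin n → K) :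
    f.threeTerm u a b c d = 0 := by
  set l : (Fin n → K) →ₗ[K] K :=
    f (Matrix.vecCons c (Matrix.vecCons d u)) • f.headForm (Matrix.vecCons b u)
      - f (Matrix.vecCons b (Matrix.vecCons d u)) • f.headForm (Matrix.vecCons c u)
      + f (Matrix.vecCons b (Matrix.vecCons c u)) • f.headForm (Matrix.vecCons d u) with hl
  have hla : ∀ x, l x = f.threeTerm u x b c d := fun x => by
    simp only [hl, threeTerm, LinearMap.add_apply, LinearMap.sub_apply, LinearMap.smul_apply,
      headForm_apply, smul_eq_mul]
    ring
  rw [← hla, eq_zero_of_momentCurve (l := l) fun t => by rw [hla, h], LinearMap.zero_apply]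

theorem isDecomposable_of_curryLeft_momentCurve {q : ℕ}
    {f : (Fin n → K) [⋀^Fin (q + 3)]→ₗ[K] K}
    (h : ∀ t, (f.curryLeft (momentCurve n t)).IsDecomposable) : f.IsDecomposable := by
  by_cases h0 : f = 0
  · rw [h0]
    exact isDecomposable_zero
  obtain ⟨s, hs⟩ : ∃ s, f.curryLeft (momentCurve n s) ≠ 0 := by
    by_contra! hc
    exact h0 (eq_zero_of_curryLeft_momentCurve hc)
  obtain ⟨t, ht⟩ : ∃ t, (f.curryLeft (momentCurve n s)).curryLeft (momentCurve n t) ≠ 0 := by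
    by_contra! hc
    exact hs (eq_zero_of_curryLeft_momentCurve hc)
  obtain ⟨y, hy⟩ :
      ∃ y, (f.curryLeft (momentCurve n s)).curryLeft (momentCurve n t) y ≠ 0 := by
    by_contra! hc
    exact ht (AlternatingMap.ext hc)
  set S := momentCurve n s with hS
  set T := momentCurve n t with hT
  simp only [curryLeft_apply_apply] at hy
  refine isDecomposable_of_curryLeft_eq_zero hy fun x hx => ?_
  have upd0 : ∀ {m : ℕ} (a b : Fin n → K) (v : Fin m → Fin n → K),
      Function.update (Matrix.vecCons a v) 0 b = Matrix.vecCons b v :=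
    fun a b v => Fin.update_cons_zero _ _ _
  have upds : ∀ {m : ℕ} (a b : Fin n → K) (v : Fin m → Fin n → K) (i : Fin m),
      Function.update (Matrix.vecCons a v) i.succ b = Matrix.vecCons a (Function.update v i b) :=
    fun a b v i => (Fin.cons_update _ _ _ _).symm
  have hxS : (f.curryLeft S).curryLeft x = 0 := by
    refine (h s).curryLeft_eq_zero (a := Matrix.vecCons T y) hy fun i => ?_
    rw [curryLeft_apply_apply, ← upds]
    exact hx _
  have hxT : (f.curryLeft T).curryLeft x = 0 := by
    refine (h t).curryLeft_eq_zero (a := Matrix.vecCons S y) ?_ fun i => ?_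
    · rw [curryLeft_apply_apply, map_vecCons_swap]
      exact neg_ne_zero.2 hy
    · rw [curryLeft_apply_apply]
      refine Fin.cases ?_ (fun i => ?_) i
      · rw [upd0, map_vecCons_swap, ← upd0 S, hx, neg_zero]
      · rw [upds, map_vecCons_swap, ← upds, ← upds, hx, neg_zero]
  set y' := Matrix.vecTail y
  set l₂ := f.headForm (Matrix.vecCons S (Matrix.vecCons T y')) with hl₂
  have hl₂0 : l₂ ≠ 0 := by
    intro hc
    apply hy
    rw [← Matrix.cons_head_tail y, map_vecCons_rotate, ← headForm_apply, ← hl₂, hc]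
    rfl
  have hxr : ∀ r, l₂ (momentCurve n r) ≠ 0 → (f.curryLeft (momentCurve n r)).curryLeft x = 0 := by
    intro r hr
    refine (h r).curryLeft_eq_zero (a := Matrix.vecCons S (Matrix.vecCons T y')) hr fun i => ?_
    rw [curryLeft_apply_apply]
    refine Fin.cases ?_ (fun i => ?_) i
    · rw [upd0]
      exact f.map_eq_zero_of_curryLeft_curryLeft (i := Fin.succ (Fin.succ 0)) (j := Fin.succ 0)
        ((Fin.succ_injective _).ne (Fin.succ_ne_zero _)) hxT
    · rw [upds]
      refine f.map_eq_zero_of_curryLeft_curryLeft (i := Fin.succ 0) (j := i.succ.succ)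
        ((Fin.succ_injective _).ne (Fin.succ_ne_zero _).symm) ?_
      rw [Matrix.cons_val_succ, Matrix.cons_val_succ, Matrix.cons_val_succ, Matrix.cons_val_zero,
        Function.update_self]
      exact hxS
  ext v
  have hl : f.headForm (Matrix.vecCons x (Matrix.vecTail v)) = 0 := by
    refine (eq_zero_or_eq_zero_of_momentCurve (l₂ := l₂) fun r => ?_).resolve_right hl₂0
    by_cases hr : l₂ (momentCurve n r) = 0
    · rw [hr, mul_zero]
    · rw [headForm_apply, ← curryLeft_apply_apply, ← curryLeft_apply_apply, hxr r hr, zero_apply,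
        zero_mul]
  rw [← Matrix.cons_head_tail v, curryLeft_apply_apply, map_vecCons_swap, ← headForm_apply, hl]
  simp

/-- An alternating form on `Kⁿ` whose contractions along points of the moment curve all satisfy the
three-term Plücker relation at points of the moment curve is decomposable. -/
theorem isDecomposable_of_threeTerm_momentCurve {q : ℕ} {f : (Fin n → K) [⋀^Fin (q + 2)]→ₗ[K] K}
    (h : ∀ (u : Fin q → K) (a b c d : K),
      f.threeTerm (fun i => momentCurve n (u i)) (momentCurve n a) (momentCurve n b)
        (momentCurve n c) (momentCurve n d) = 0) : f.IsDecomposable := by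
  induction q with
  | zero =>
    refine isDecomposable_of_threeTerm_eq_zero ?_
    have h1 : ∀ a b c d, f.threeTerm ![] a (momentCurve n b) (momentCurve n c)
        (momentCurve n d) = 0 := fun a b c d =>
      threeTerm_eq_zero_of_momentCurve (fun t => by
        convert h ![] t b c d using 2) a
    have h2 : ∀ a b c d, f.threeTerm ![] b (momentCurve n c) (momentCurve n d) a = 0 :=
      fun a b c d => threeTerm_eq_zero_of_momentCurve
        (fun t => by rw [threeTerm_rotate, h1, neg_zero]) b
    have h3 : ∀ a b c d, f.threeTerm ![] c (momentCurve n d) a b = 0 :=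
      fun a b c d => threeTerm_eq_zero_of_momentCurve
        (fun t => by rw [threeTerm_rotate, h2, neg_zero]) c
    exact fun d a b c => threeTerm_eq_zero_of_momentCurve
      (fun t => by rw [threeTerm_rotate, h3, neg_zero]) d
  | succ q ih =>
    refine isDecomposable_of_curryLeft_momentCurve fun t => ih fun u a b c d => ?_
    rw [← threeTerm_vecCons]
    convert h (Matrix.vecCons t u) a b c d using 2
    funext i
    refine Fin.cases ?_ (fun i => ?_) i <;> simp

end AlternatingMap

end MomentCurve

section Coordinates

theorem coordA_apply {F : Type*} [Field F] {n q : ℕ} (idx : Fin q → Fin n)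
    (v : Fin q → Fin n → F) :
    coordA F q idx v = (Matrix.of fun a b => v a (idx b)).det := rfl

theorem coordF_ιMulti {F : Type*} [Field F] {n q : ℕ} (idx : Fin q → Fin n)
    (v : Fin q → Fin n → F) :
    coordF F q idx (ιMulti F q v) = (Matrix.of fun a b => v a (idx b)).det := by
  rw [coordF, liftAlternating_apply_ιMulti, Function.update_self, coordA_apply]

theorem coordF_ιMulti_of_eq {F : Type*} [Field F] {n q m : ℕ} (h : q = m) (idx : Fin q → Fin n)
    (v : Fin m → Fin n → F) :
    coordF F q idx (ιMulti F m v) = (Matrix.of fun a b => v (Fin.cast h a) (idx b)).det := by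
  subst h
  exact coordF_ιMulti idx v

theorem coordF_orderEmb_eq_repr {F : Type*} [Field F] {n p : ℕ} (ω : ⋀[F]^p (Fin n → F))
    (s : Set.powersetCard (Fin n) p) :
    coordF F p (fun a => (s.1.orderIsoOfFin s.2 a : Fin n)) ω.val =
      ((Pi.basisFun F (Fin n)).exteriorPower p).repr ω s := by
  rw [exteriorPower.basis_repr_apply]
  have h : (coordF F p (fun a => (s.1.orderIsoOfFin s.2 a : Fin n))).comp
      (⋀[F]^p (Fin n → F)).subtype =
        exteriorPower.ιMultiDual F p (Pi.basisFun F (Fin n)) s := by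
    ext v
    simp only [LinearMap.compAlternatingMap_apply, LinearMap.comp_apply, Submodule.subtype_apply,
      exteriorPower.ιMulti_apply_coe, coordF_ιMulti, exteriorPower.ιMultiDual_apply_ιMulti]
    rfl
  exact LinearMap.congr_fun h ω

theorem eq_sum_coordF_smul {F : Type*} [Field F] {n p : ℕ} {ω : ExteriorAlgebra F (Fin n → F)}
    (hω : ω ∈ ⋀[F]^p (Fin n → F)) :
    ∑ s : {s : Finset (Fin n) // s.card = p},
      coordF F p (fun a => (s.1.orderIsoOfFin s.2 a : Fin n)) ω •
        ιMulti F p (fun a => Pi.single ((s.1.orderIsoOfFin s.2 a : Fin n)) (1 : F)) = ω := by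
  have h := ((Pi.basisFun F (Fin n)).exteriorPower p).sum_repr ⟨ω, hω⟩
  have h' := congrArg Subtype.val h
  rw [AddSubmonoidClass.coe_finsetSum] at h'
  refine Eq.trans (Eq.symm ?_) h'
  refine Finset.sum_bij (fun s _ => s) (fun _ _ => Finset.mem_univ _) (fun _ _ _ _ h => h)
    (fun s _ => ⟨s, Finset.mem_univ _, rfl⟩) fun s _ => ?_
  rw [coordF_orderEmb_eq_repr ⟨ω, hω⟩ s, Submodule.coe_smul, exteriorPower.basis_apply]
  refine congrArg (_ • ·) (congrArg (ιMulti F p) (funext fun a => ?_))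
  exact Pi.basisFun_apply F (Fin n) _

theorem eq_of_coordF_eq {F : Type*} [Field F] {n p : ℕ} {x y : ExteriorAlgebra F (Fin n → F)}
    (hx : x ∈ ⋀[F]^p (Fin n → F)) (hy : y ∈ ⋀[F]^p (Fin n → F))
    (h : ∀ idx : Fin p → Fin n, coordF F p idx x = coordF F p idx y) : x = y := by
  rw [← eq_sum_coordF_smul hx, ← eq_sum_coordF_smul hy]
  simp only [h]

theorem ιMulti_mem {F : Type*} [Field F] {n p : ℕ} (v : Fin p → Fin n → F) :
    ιMulti F p v ∈ ⋀[F]^p (Fin n → F) :=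
  ExteriorAlgebra.ιMulti_range F p (Set.mem_range_self v)

variable {k : Type*} [Field k] {n : ℕ}

/-- The alternating form on `Kⁿ` whose coefficients are the images under `σ : k → K` of the
coordinates of `ω`. -/
def toForm {K : Type*} [Field K] (σ : k →+* K) (p : ℕ) (ω : ExteriorAlgebra k (Fin n → k)) :
    (Fin n → K) [⋀^Fin p]→ₗ[K] K :=
  ∑ s : {s : Finset (Fin n) // s.card = p},
    σ (coordF k p (fun a => (s.1.orderIsoOfFin s.2 a : Fin n)) ω) •
      coordA K p (fun a => (s.1.orderIsoOfFin s.2 a : Fin n))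

theorem toForm_apply {K : Type*} [Field K] (σ : k →+* K) (p : ℕ)
    (ω : ExteriorAlgebra k (Fin n → k)) (x : Fin p → Fin n → K) :
    toForm σ p ω x = ∑ s : {s : Finset (Fin n) // s.card = p},
      σ (coordF k p (fun a => (s.1.orderIsoOfFin s.2 a : Fin n)) ω) *
        (Matrix.of fun a b => x a (s.1.orderIsoOfFin s.2 b : Fin n)).det := by
  exact map_sum (⟨⟨fun f => f x, rfl⟩, fun _ _ => rfl⟩ : (Fin n → K) [⋀^Fin p]→ₗ[K] K →+ K) _ _

theorem toForm_single {K : Type*} [Field K] (σ : k →+* K) {p : ℕ}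
    {ω : ExteriorAlgebra k (Fin n → k)} (hω : ω ∈ ⋀[k]^p (Fin n → k)) (idx : Fin p → Fin n) :
    toForm σ p ω (fun a => Pi.single (idx a) 1) = σ (coordF k p idx ω) := by
  conv_rhs => rw [← eq_sum_coordF_smul hω]
  rw [toForm_apply, map_sum, map_sum]
  refine Finset.sum_congr rfl fun s _ => ?_
  rw [map_smul, smul_eq_mul, map_mul, coordF_ιMulti, RingHom.map_det, ← Matrix.det_transpose]
  congr 2
  ext a b
  simp [Pi.single_apply, eq_comm]

theorem isDecomp_of_isDecomposable_toForm {K : Type*} [Field K] (σ : k →+* K) {p : ℕ}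
    {ω : ExteriorAlgebra k (Fin n → k)} (hω : ω ∈ ⋀[k]^(p + 1) (Fin n → k))
    (h : (toForm σ (p + 1) ω).IsDecomposable) : IsDecomp k (p + 1) ω := by
  by_cases h0 : ∀ idx : Fin (p + 1) → Fin n, coordF k (p + 1) idx ω = 0
  · refine ⟨0, eq_of_coordF_eq hω (ιMulti_mem _) fun idx => ?_⟩
    rw [h0, AlternatingMap.map_zero, map_zero]
  push Not at h0
  obtain ⟨I, hI⟩ := h0
  have hf : toForm σ (p + 1) ω (fun a => Pi.single (I a) 1) ≠ 0 := by
    rw [toForm_single σ hω]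
    exact (map_ne_zero σ).2 hI
  set w : Fin (p + 1) → Fin n → k :=
    fun i m => (coordF k (p + 1) I ω)⁻¹ * coordF k (p + 1) (Function.update I i m) ω with hw
  refine ⟨Function.update w 0 (coordF k (p + 1) I ω • w 0),
    eq_of_coordF_eq hω (ιMulti_mem _) fun J => ?_⟩
  rw [AlternatingMap.map_update_smul, Function.update_eq_self, map_smul, coordF_ιMulti,
    smul_eq_mul]
  apply σ.injective
  have key := AlternatingMap.eq_mul_det_of_curryLeft_eq_zero hf
    (fun x hx => h.curryLeft_eq_zero hf hx) (fun a => Pi.single (J a) 1)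
  rw [toForm_single σ hω, toForm_single σ hω] at key
  rw [key, map_mul, RingHom.map_det]
  congr 2
  ext i j
  have hu : Function.update (fun a => (Pi.single (I a) 1 : Fin n → K)) i (Pi.single (J j) 1) =
      fun a => Pi.single (Function.update I i (J j) a) 1 := by
    funext a
    by_cases ha : a = i
    · subst ha; simp
    · simp [ha]
  simp only [Matrix.of_apply, hu, toForm_single σ hω, hw, RingHom.mapMatrix_apply, Matrix.map_apply,
    map_mul, map_inv₀]

theorem baseChangeHom_ιMulti {K : Type*} [Field K] (σ : k →+* K) {p : ℕ} (v : Fin p → Fin n → k) :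
    baseChangeHom k K σ p (ιMulti k p v) = ιMulti K p (fun a i => σ (v a i)) := by
  rw [← eq_sum_coordF_smul (ιMulti_mem fun a i => σ (v a i)), baseChangeHom]
  refine Finset.sum_congr rfl fun s _ => ?_
  rw [coordF_ιMulti, coordF_ιMulti, RingHom.map_det]
  rfl

/-- The value of an exterior form at points of the moment curve with parameters in a commutative
`k`-algebra. -/
def momentValue {S : Type*} [CommRing S] (σ : k →+* S) (p : ℕ)
    (ω : ExteriorAlgebra k (Fin n → k)) (x : Fin p → S) : S :=
  ∑ s : {s : Finset (Fin n) // s.card = p},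
    σ (coordF k p (fun a => (s.1.orderIsoOfFin s.2 a : Fin n)) ω) *
      (Matrix.of fun a b => momentCurve n (x a) (s.1.orderIsoOfFin s.2 b : Fin n)).det

theorem map_momentValue {S T : Type*} [CommRing S] [CommRing T] (σ : k →+* S) (τ : S →+* T)
    (p : ℕ) (ω : ExteriorAlgebra k (Fin n → k)) (x : Fin p → S) :
    τ (momentValue σ p ω x) = momentValue (τ.comp σ) p ω fun a => τ (x a) := by
  rw [momentValue, momentValue, map_sum]
  refine Finset.sum_congr rfl fun s _ => ?_
  rw [map_mul, RingHom.map_det]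
  congr 2
  ext a b
  simp [momentCurve]

theorem toForm_momentCurve {K : Type*} [Field K] (σ : k →+* K) (p : ℕ)
    (ω : ExteriorAlgebra k (Fin n → k)) (x : Fin p → K) :
    toForm σ p ω (fun a => momentCurve n (x a)) = momentValue σ p ω x :=
  toForm_apply _ _ _ _

theorem coordF_vandL {K : Type*} [Field K] (σ : k →+* K) (p : ℕ)
    (ω : ExteriorAlgebra k (Fin n → k)) (x : Fin (p + 2) → K) (idx : Fin p → Fin (p + 2)) :
    coordF K p idx (ExteriorAlgebra.map (vandL K p n x) (baseChangeHom k K σ p ω)) =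
      momentValue σ p ω fun a => x (idx a) := by
  rw [baseChangeHom, map_sum, map_sum, momentValue]
  refine Finset.sum_congr rfl fun s _ => ?_
  rw [map_smul, map_smul, smul_eq_mul, map_apply_ιMulti, coordF_ιMulti, ← Matrix.det_transpose]
  congr 2
  ext a b
  simp [vandL, momentCurve]

end Coordinates

section ParametricProjection

/-- The index tuple `(k, l, 4, 5, …)`. -/
def pairTuple (q : ℕ) (k l : Fin 4) : Fin (q + 2) → Fin (q + 2 + 2) :=
  Matrix.vecCons (Fin.castLE (by omega) k)
    (Matrix.vecCons (Fin.castLE (by omega) l) fun a => ⟨a + 4, by omega⟩)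

theorem comp_pairTuple {M : Type*} {q : ℕ} (g : Fin (q + 2 + 2) → M) (k l : Fin 4) :
    (fun a => g (pairTuple q k l a)) =
      Matrix.vecCons (g (Fin.castLE (by omega) k))
        (Matrix.vecCons (g (Fin.castLE (by omega) l)) fun a : Fin q => g ⟨a + 4, by omega⟩) := by
  funext a
  refine Fin.cases rfl (fun a => ?_) a
  exact Fin.cases rfl (fun a => rfl) a

theorem strictMono_pairTuple {q : ℕ} {k l : Fin 4} (hkl : k < l) :
    StrictMono (pairTuple q k l) := by
  refine Fin.strictMono_iff_lt_succ.2 fun i => ?_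
  refine Fin.cases ?_ (fun i => ?_) i
  · exact hkl
  · rcases q with _ | q
    · exact i.elim0
    · refine Fin.cases ?_ (fun i => ?_) i
      · simp [pairTuple, Fin.lt_def]
      · simp [pairTuple, Fin.lt_def]

theorem pairTuple_ne {q : ℕ} {k l i : Fin 4} (hk : k ≠ i) (hl : l ≠ i) (a : Fin (q + 2)) :
    pairTuple q k l a ≠ Fin.castLE (by omega) i := by
  refine Fin.cases ?_ (fun a => ?_) a
  · simpa [pairTuple] using hk
  · refine Fin.cases ?_ (fun a => ?_) a
    · simpa [pairTuple] using hl
    · simp [pairTuple, Fin.ext_iff]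
      omega

theorem coordF_map_dualAt {F : Type*} [Field F] {q : ℕ}
    (y : ExteriorAlgebra F (Fin (q + 2 + 2) → F)) {i j k l : Fin 4} (hij : i < j) (hkl : k < l)
    (hki : k ≠ i) (hkj : k ≠ j) (hli : l ≠ i) (hlj : l ≠ j) :
    coordF F 2 ![i, j] (ExteriorAlgebra.map (Matrix.of fun (i : Fin 4) (j : Fin (q + 2 + 2)) =>
      if (j : ℕ) = (i : ℕ) then (1 : F) else 0).mulVecLin (dualAt F (q + 2 + 2) (q + 2) y)) =
    coordF F (q + 2) (pairTuple q k l) y := by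
  set Z : (Fin (q + 2 + 2) → F) →ₗ[F] (Fin 4 → F) :=
    (Matrix.of fun (i : Fin 4) (j : Fin (q + 2 + 2)) =>
      if (j : ℕ) = (i : ℕ) then (1 : F) else 0).mulVecLin with hZ'
  have hZ (m : Fin (q + 2 + 2)) (b : Fin 4) :
      Z (Pi.single m 1) b = if m = Fin.castLE (by omega) b then 1 else 0 := by
    simp [hZ', Fin.ext_iff]
  have h2 : 2 = q + 2 + 2 - (q + 2) := by omega
  set i' : Fin (q + 2 + 2) := Fin.castLE (by omega) i with hi'
  set j' : Fin (q + 2 + 2) := Fin.castLE (by omega) j with hj'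
  have hij' : i' < j' := hij
  have hcard : (({i', j'} : Finset (Fin (q + 2 + 2)))ᶜ).card = q + 2 := by
    rw [Finset.card_compl, Finset.card_pair hij'.ne, Fintype.card_fin]
    omega
  have hterm (t : Fin (q + 2 + 2 - (q + 2)) → Fin (q + 2 + 2)) (ht : StrictMono t) :
      coordF F 2 ![i, j] (ExteriorAlgebra.map Z
        (ιMulti F (q + 2 + 2 - (q + 2)) fun a => Pi.single (t a) (1 : F))) =
        if t (Fin.cast h2 0) = i' ∧ t (Fin.cast h2 1) = j' then 1 else 0 := by
    have hlt : t (Fin.cast h2 0) < t (Fin.cast h2 1) := ht (by simp [Fin.lt_def])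
    rw [map_apply_ιMulti, coordF_ιMulti_of_eq h2, Matrix.det_fin_two]
    have hn : ¬ (t (Fin.cast h2 0) = j' ∧ t (Fin.cast h2 1) = i') := by
      rintro ⟨h, h'⟩
      rw [h, h'] at hlt
      exact lt_asymm hlt hij'
    change Z _ i * Z _ j - Z _ j * Z _ i = _
    rw [hZ, hZ, hZ, hZ, ite_zero_mul_ite_zero, ite_zero_mul_ite_zero, mul_one, if_neg hn, sub_zero]
  have hmono (s : {s : Finset (Fin (q + 2 + 2)) // s.card = q + 2}) :
      StrictMono fun a => (s.1ᶜ.orderIsoOfFin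
        (by rw [Finset.card_compl, s.2, Fintype.card_fin]) a : Fin (q + 2 + 2)) :=
    fun a b hab => (s.1ᶜ.orderIsoOfFin _).strictMono hab
  rw [dualAt, map_sum, map_sum, Finset.sum_eq_single ⟨({i', j'} : Finset _)ᶜ, hcard⟩]
  · rw [map_smul, map_smul, smul_eq_mul, hterm _ (hmono _), if_pos, mul_one]
    · congr 1
      congr 1
      symm
      refine Finset.orderEmbOfFin_unique hcard (fun a => ?_) (strictMono_pairTuple hkl)
      simp only [Finset.mem_compl, Finset.mem_insert, Finset.mem_singleton, not_or]
      exact ⟨pairTuple_ne hki hli a, pairTuple_ne hkj hlj a⟩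
    · have hlt := hmono ⟨({i', j'} : Finset _)ᶜ, hcard⟩
        (a := Fin.cast h2 0) (b := Fin.cast h2 1) (by simp [Fin.lt_def])
      have hmem (a) := (((({i', j'} : Finset (Fin (q + 2 + 2)))ᶜ)ᶜ).orderIsoOfFin
        (by rw [Finset.card_compl, hcard, Fintype.card_fin] : _ = q + 2 + 2 - (q + 2)) a).2
      have h0 := hmem (Fin.cast h2 0)
      have h1 := hmem (Fin.cast h2 1)
      simp only [compl_compl, Finset.mem_insert, Finset.mem_singleton] at h0 h1 hlt ⊢
      rcases h0 with h0 | h0 <;> rcases h1 with h1 | h1 <;> rw [h0, h1] at hlt ⊢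
      · exact absurd hlt (lt_irrefl _)
      · exact ⟨rfl, rfl⟩
      · exact absurd hlt (lt_asymm hij')
      · exact absurd hlt (lt_irrefl _)
  · intro s _ hs
    rw [map_smul, map_smul, smul_eq_mul, hterm _ (hmono s), if_neg, mul_zero]
    rintro ⟨h0, h1⟩
    refine hs (Subtype.ext (compl_eq_comm.1 (Finset.eq_of_subset_of_card_le ?_ ?_).symm).symm)
    · intro x hx
      rcases Finset.mem_insert.1 hx with rfl | hx
      · rw [← h0]
        exact Subtype.prop _
      · rw [Finset.mem_singleton.1 hx, ← h1]
        exact Subtype.prop _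
    · rw [Finset.card_compl, s.2, Fintype.card_fin, Finset.card_pair hij'.ne]
      omega
  · exact fun h => absurd (Finset.mem_univ _) h

end ParametricProjection

section ParametricQuadric

theorem isDecomposable_two_of_single {F : Type*} [Field F]
    {f : (Fin 4 → F) [⋀^Fin 2]→ₗ[F] F}
    (h : f.threeTerm ![] (Pi.single 0 1) (Pi.single 1 1) (Pi.single 2 1) (Pi.single 3 1) = 0) :
    f.IsDecomposable := by
  have hs (x y : Fin 4 → F) : f (Matrix.vecCons x ![y]) = -f (Matrix.vecCons y ![x]) :=
    f.map_vecCons_swap x y ![]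
  have hl (x y : Fin 4 → F) : f (Matrix.vecCons x ![y]) =
      ∑ i, x i * f (Matrix.vecCons (Pi.single i 1) ![y]) := by
    have h' := congrArg (f.headForm ![y]) (pi_eq_sum_univ' x)
    simpa only [map_sum, map_smul, smul_eq_mul, AlternatingMap.headForm_apply] using h'
  have hd (x : Fin 4 → F) : f (Matrix.vecCons x ![x]) = 0 :=
    f.map_eq_zero_of_eq _ (i := 0) (j := 1) rfl (by decide)
  have key (x y : Fin 4 → F) : f (Matrix.vecCons x ![y]) =
      (x 0 * y 1 - x 1 * y 0) * f (Matrix.vecCons (Pi.single 0 1) ![Pi.single 1 1]) +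
      (x 0 * y 2 - x 2 * y 0) * f (Matrix.vecCons (Pi.single 0 1) ![Pi.single 2 1]) +
      (x 0 * y 3 - x 3 * y 0) * f (Matrix.vecCons (Pi.single 0 1) ![Pi.single 3 1]) +
      (x 1 * y 2 - x 2 * y 1) * f (Matrix.vecCons (Pi.single 1 1) ![Pi.single 2 1]) +
      (x 1 * y 3 - x 3 * y 1) * f (Matrix.vecCons (Pi.single 1 1) ![Pi.single 3 1]) +
      (x 2 * y 3 - x 3 * y 2) * f (Matrix.vecCons (Pi.single 2 1) ![Pi.single 3 1]) := by
    rw [hl]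
    simp only [hs _ y]
    simp only [hl y, Fin.sum_univ_four, hd]
    rw [hs (Pi.single 1 1) (Pi.single 0 1), hs (Pi.single 2 1) (Pi.single 0 1),
      hs (Pi.single 3 1) (Pi.single 0 1), hs (Pi.single 2 1) (Pi.single 1 1),
      hs (Pi.single 3 1) (Pi.single 1 1), hs (Pi.single 3 1) (Pi.single 2 1)]
    ring
  refine AlternatingMap.isDecomposable_of_threeTerm_eq_zero fun a b c d => ?_
  simp only [AlternatingMap.threeTerm] at h ⊢
  rw [key a b, key c d, key a c, key b d, key a d, key b c]
  linear_combination
    ((a 0 * b 1 - a 1 * b 0) * (c 2 * d 3 - c 3 * d 2)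
      - (a 0 * b 2 - a 2 * b 0) * (c 1 * d 3 - c 3 * d 1)
      + (a 0 * b 3 - a 3 * b 0) * (c 1 * d 2 - c 2 * d 1)
      + (a 1 * b 2 - a 2 * b 1) * (c 0 * d 3 - c 3 * d 0)
      - (a 1 * b 3 - a 3 * b 1) * (c 0 * d 2 - c 2 * d 0)
      + (a 2 * b 3 - a 3 * b 2) * (c 0 * d 1 - c 1 * d 0)) * h

theorem dualAt_mem {F : Type*} [Field F] {n p m : ℕ} (h : n - p = m)
    (y : ExteriorAlgebra F (Fin n → F)) : dualAt F n p y ∈ ⋀[F]^m (Fin n → F) := by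
  subst h
  exact Submodule.sum_mem _ fun s _ => Submodule.smul_mem _ _ (ιMulti_mem _)

theorem map_mem {F : Type*} [Field F] {n m p : ℕ} (f : (Fin n → F) →ₗ[F] (Fin m → F))
    {x : ExteriorAlgebra F (Fin n → F)} (hx : x ∈ ⋀[F]^p (Fin n → F)) :
    ExteriorAlgebra.map f x ∈ ⋀[F]^p (Fin m → F) := by
  rw [← eq_sum_coordF_smul hx, map_sum]
  refine Submodule.sum_mem _ fun s _ => ?_
  rw [map_smul, map_apply_ιMulti]
  exact Submodule.smul_mem _ _ (ιMulti_mem _)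

variable {k : Type*} [Field k] {n : ℕ}

theorem HQ_eq_coordF_XQω {q : ℕ} (ω : ExteriorAlgebra k (Fin n → k)) :
    HQ k (q + 2) n ω =
      coordF (Qf k (q + 2)) (q + 2) (pairTuple q 0 1) (XQω k (q + 2) n ω) *
        coordF (Qf k (q + 2)) (q + 2) (pairTuple q 2 3) (XQω k (q + 2) n ω)
      - coordF (Qf k (q + 2)) (q + 2) (pairTuple q 0 2) (XQω k (q + 2) n ω) *
        coordF (Qf k (q + 2)) (q + 2) (pairTuple q 1 3) (XQω k (q + 2) n ω)
      + coordF (Qf k (q + 2)) (q + 2) (pairTuple q 0 3) (XQω k (q + 2) n ω) *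
        coordF (Qf k (q + 2)) (q + 2) (pairTuple q 1 2) (XQω k (q + 2) n ω) := by
  have h {i j k' l : Fin 4} (hij : i < j) (hkl : k' < l) (hki : k' ≠ i) (hkj : k' ≠ j)
      (hli : l ≠ i) (hlj : l ≠ j) :
      coordF (Qf k (q + 2)) 2 ![i, j] (GQ k (q + 2) n ω) =
        coordF (Qf k (q + 2)) (q + 2) (pairTuple q k' l) (XQω k (q + 2) n ω) :=
    coordF_map_dualAt _ hij hkl hki hkj hli hlj
  rw [HQ, h (i := 0) (j := 1) (k' := 2) (l := 3), h (i := 2) (j := 3) (k' := 0) (l := 1),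
    h (i := 0) (j := 2) (k' := 1) (l := 3), h (i := 1) (j := 3) (k' := 0) (l := 2),
    h (i := 0) (j := 3) (k' := 1) (l := 2), h (i := 1) (j := 2) (k' := 0) (l := 3)]
  · ring
  all_goals decide

theorem HQ_eq_zero_of_isDecomp_XQω {q : ℕ} {ω : ExteriorAlgebra k (Fin n → k)}
    (h : IsDecomp (Qf k (q + 2)) (q + 2) (XQω k (q + 2) n ω)) : HQ k (q + 2) n ω = 0 := by
  obtain ⟨v, hv⟩ := h
  let f : (Fin (q + 2 + 2) → Qf k (q + 2)) [⋀^Fin (q + 2)]→ₗ[Qf k (q + 2)] Qf k (q + 2) :=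
    (Matrix.detRowAlternating (n := Fin (q + 2)) (R := Qf k (q + 2))).compLinearMap
      (Matrix.of v).mulVecLin
  have hf : f.IsDecomposable := by
    refine ⟨1, fun i => (LinearMap.proj i).comp (Matrix.of v).mulVecLin, fun x => ?_⟩
    rw [one_mul, ← Matrix.det_transpose]
    rfl
  have hidx (idx : Fin (q + 2) → Fin (q + 2 + 2)) :
      coordF (Qf k (q + 2)) (q + 2) idx (XQω k (q + 2) n ω) =
        f fun a => Pi.single (idx a) 1 := by
    rw [hv, coordF_ιMulti, ← Matrix.det_transpose]
    refine congrArg Matrix.det ?_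
    ext a b
    simp
  have h3 := hf.threeTerm_eq_zero
    (fun a : Fin q => Pi.single ⟨a + 4, by omega⟩ 1)
    (Pi.single (Fin.castLE (by omega) (0 : Fin 4)) 1)
    (Pi.single (Fin.castLE (by omega) (1 : Fin 4)) 1)
    (Pi.single (Fin.castLE (by omega) (2 : Fin 4)) 1)
    (Pi.single (Fin.castLE (by omega) (3 : Fin 4)) 1)
  rw [HQ_eq_coordF_XQω]
  simp only [hidx, comp_pairTuple fun m => (Pi.single m 1 : Fin (q + 2 + 2) → Qf k (q + 2))]
  exact h3

theorem isDecomp_of_HQ_eq_zero {q : ℕ} {ω : ExteriorAlgebra k (Fin n → k)}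
    (hω : ω ∈ ⋀[k]^(q + 2) (Fin n → k)) (h : HQ k (q + 2) n ω = 0) : IsDecomp k (q + 2) ω := by
  have hidx (idx : Fin (q + 2) → Fin (q + 2 + 2)) :
      coordF (Qf k (q + 2)) (q + 2) idx (XQω k (q + 2) n ω) =
        algebraMap (MvPolynomial (Fin (q + 2 + 2)) k) (Qf k (q + 2))
          (momentValue MvPolynomial.C (q + 2) ω fun a => MvPolynomial.X (idx a)) := by
    rw [map_momentValue]
    exact coordF_vandL _ _ _ _ _
  rw [HQ_eq_coordF_XQω] at h
  simp only [hidx, ← map_mul, ← map_sub, ← map_add] at h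
  rw [map_eq_zero_iff _ (IsFractionRing.injective _ _)] at h
  refine isDecomp_of_isDecomposable_toForm (algebraMap k (AlgebraicClosure k)) hω
    (AlternatingMap.isDecomposable_of_threeTerm_momentCurve fun u a b c d => ?_)
  let t : Fin (q + 2 + 2) → AlgebraicClosure k := fun i =>
    Matrix.vecCons a (Matrix.vecCons b (Matrix.vecCons c (Matrix.vecCons d u)))
      (Fin.cast (by omega) i)
  have h' := congrArg (MvPolynomial.eval₂Hom (algebraMap k (AlgebraicClosure k)) t) h
  simp only [map_mul, map_sub, map_add, map_momentValue, map_zero, MvPolynomial.eval₂Hom_X',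
    ← toForm_momentCurve] at h'
  simp only [comp_pairTuple fun m => (momentCurve n (t m))] at h'
  have hC : (MvPolynomial.eval₂Hom (algebraMap k (AlgebraicClosure k)) t).comp MvPolynomial.C =
      algebraMap k (AlgebraicClosure k) := MvPolynomial.eval₂Hom_comp_C _ _
  rw [hC] at h'
  exact h'

theorem isDecomp_GQ_of_HQ_eq_zero {q : ℕ} {ω : ExteriorAlgebra k (Fin n → k)}
    (h : HQ k (q + 2) n ω = 0) : IsDecomp (Qf k (q + 2)) 2 (GQ k (q + 2) n ω) := by
  have hG : GQ k (q + 2) n ω ∈ ⋀[Qf k (q + 2)]^2 (Fin 4 → Qf k (q + 2)) :=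
    map_mem _ (dualAt_mem (by omega) _)
  refine isDecomp_of_isDecomposable_toForm (RingHom.id _) hG (isDecomposable_two_of_single ?_)
  have hs (i j : Fin 4) : toForm (RingHom.id (Qf k (q + 2))) 2 (GQ k (q + 2) n ω)
      (Matrix.vecCons (Pi.single i 1) ![Pi.single j 1]) =
        coordF (Qf k (q + 2)) 2 ![i, j] (GQ k (q + 2) n ω) := by
    refine Eq.trans (congrArg _ ?_) (toForm_single (RingHom.id _) hG ![i, j])
    funext a
    fin_cases a <;> rfl
  simp only [AlternatingMap.threeTerm, hs]
  exact h

theorem HQ_eq_zero_of_isDecomp_GQ {p : ℕ} {ω : ExteriorAlgebra k (Fin n → k)}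
    (h : IsDecomp (Qf k p) 2 (GQ k p n ω)) : HQ k p n ω = 0 := by
  obtain ⟨w, hw⟩ := h
  simp only [HQ, hw, coordF_ιMulti, Matrix.det_fin_two, Matrix.of_apply, Matrix.cons_val_zero,
    Matrix.cons_val_one]
  ring

theorem isDecomp_XQω_of_isDecomp {p : ℕ} {ω : ExteriorAlgebra k (Fin n → k)}
    (h : IsDecomp k p ω) : IsDecomp (Qf k p) p (XQω k p n ω) := by
  obtain ⟨v, rfl⟩ := h
  exact ⟨_, by rw [XQω, baseChangeHom_ιMulti, map_apply_ιMulti]⟩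

end ParametricQuadric

/-- For `2 ≤ p ≤ n-2` and `ω ∈ ⋀^p k^n`, the following are equivalent:
(1) `ω` is decomposable; (2) `⋀^p X(ω)` is decomposable over `Q`; (3) `G(ω)` is
decomposable over `Q`; (4) `H(ω) = 0`. -/
theorem decomposable_tfae_parametric
    {k : Type*} [Field k] {p n : ℕ} (hp : 2 ≤ p) (hpn : p ≤ n - 2)
    (ω : ⋀[k]^p (Fin n → k)) :
    List.TFAE
      [ IsDecomp k p ω.val,
        IsDecomp (Qf k p) p (XQω k p n ω.val),
        IsDecomp (Qf k p) 2 (GQ k p n ω.val),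
        HQ k p n ω.val = 0 ] := by
  obtain ⟨q, rfl⟩ := Nat.exists_eq_add_of_le' hp
  tfae_have 1 → 2 := isDecomp_XQω_of_isDecomp
  tfae_have 2 → 4 := HQ_eq_zero_of_isDecomp_XQω
  tfae_have 4 → 1 := isDecomp_of_HQ_eq_zero ω.2
  tfae_have 3 → 4 := HQ_eq_zero_of_isDecomp_GQ
  tfae_have 4 → 3 := isDecomp_GQ_of_HQ_eq_zero
  tfae_finish
end

section
/- Let 0 ≤ q ≤ n and let V' be a q-dimensional subspace of k^n. Then the Q-linear map X: Q^n → Q^{p+2} restricted to the Q-subspace V' ⊗_k Q of Q^n has rank min{p+2, q}. -/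
open ExteriorAlgebra

/-- A matrix over a field with linearly independent rows has a nonzero maximal minor. -/
theorem exists_submatrix_det_ne_zero {K ι κ : Type*} [Field K] [Fintype ι] [DecidableEq ι]
    [Fintype κ] {A : Matrix ι κ K} (hA : LinearIndependent K A.row) :
    ∃ d : ι → κ, (A.submatrix id d).det ≠ 0 := by
  obtain ⟨μ, a, ha, hspan, hli⟩ := exists_linearIndependent' K A.col
  have : Finite μ := Finite.of_injective a ha
  have := Fintype.ofFinite μ
  have hcard : Fintype.card ι = Fintype.card μ := by
    rw [← hA.rank_matrix, A.rank_eq_finrank_span_cols, ← hspan]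
    exact finrank_span_eq_card hli
  let e := Fintype.equivOfCardEq hcard
  refine ⟨a ∘ e, ?_⟩
  have hcols : LinearIndependent K (A.submatrix id (a ∘ e)).col :=
    hli.comp e e.injective
  exact ((Matrix.isUnit_iff_isUnit_det _).mp
    (Matrix.linearIndependent_cols_iff_isUnit.mp hcols)).ne_zero

open MvPolynomial in
/-- For injective `e`, the coefficient of `∏ i, X (e i) ^ d i` in the determinant of the
polynomials with coefficient rows `A j`, evaluated at the variables `X (e i)`, is the minor of `A`
on the columns `d`. -/
theorem coeff_det_sum_C_mul_X_pow {R ι σ : Type*} [CommRing R] [Fintype ι] [DecidableEq ι]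
    {n : ℕ} (A : Matrix ι (Fin n) R) {e : ι → σ} (he : Function.Injective e) (d : ι → Fin n) :
    coeff (∑ i, Finsupp.single (e i) (d i : ℕ))
      (Matrix.of fun j i => ∑ l : Fin n, C (A j l) * X (e i) ^ (l : ℕ)).det =
      (A.submatrix id d).det := by
  classical
  have hinj : ∀ φ : ι → Fin n,
      ∑ i, Finsupp.single (e i) (φ i : ℕ) = ∑ i, Finsupp.single (e i) (d i : ℕ) ↔ φ = d := by
    refine fun φ => ⟨fun h => funext fun i => Fin.ext ?_, fun h => by rw [h]⟩
    simpa [Finsupp.finsetSum_apply, Finsupp.single_apply, he.eq_iff] using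
      DFunLike.congr_fun h (e i)
  rw [Matrix.det_apply', Matrix.det_apply', coeff_sum]
  refine Finset.sum_congr rfl fun τ _ => ?_
  have hprod : ∏ i, ∑ l : Fin n, C (A (τ i) l) * X (e i) ^ (l : ℕ) =
      ∑ φ : ι → Fin n,
        monomial (∑ i, Finsupp.single (e i) (φ i : ℕ)) (∏ i, A (τ i) (φ i)) := by
    rw [Finset.prod_univ_sum, Fintype.piFinset_univ]
    refine Finset.sum_congr rfl fun φ _ => ?_
    rw [monomial_sum_index, map_prod, ← Finset.prod_mul_distrib]
    exact Finset.prod_congr rfl fun i _ => by rw [X_pow_eq_monomial]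
  have hsign : ((Equiv.Perm.sign τ : ℤ) : MvPolynomial σ R) = C ((Equiv.Perm.sign τ : ℤ) : R) := by
    simp
  simp only [Matrix.of_apply, Matrix.submatrix_apply, id]
  rw [hsign, coeff_C_mul, hprod, coeff_sum]
  simp [coeff_monomial, hinj]

/-- A `k`-linearly independent family of at most `p + 2` vectors of `k^n` is sent by `X` to a
`Q`-linearly independent family. -/
theorem linearIndependent_XQ {k : Type*} [Field k] {p n m : ℕ} (hm : m ≤ p + 2)
    {b : Fin m → Fin n → k} (hb : LinearIndependent k b) :
    LinearIndependent (Qf k p) fun j => XQ k p n fun i => kToQ k p (b j i) := by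
  let A : Matrix (Fin m) (Fin n) k := Matrix.of b
  let e : Fin m → Fin (p + 2) := Fin.castLE hm
  have he : Function.Injective e := Fin.castLE_injective hm
  obtain ⟨d, hd⟩ := exists_submatrix_det_ne_zero (A := A) hb
  let D : Matrix (Fin m) (Fin m) (MvPolynomial (Fin (p + 2)) k) :=
    Matrix.of fun j i => ∑ l : Fin n, MvPolynomial.C (A j l) * MvPolynomial.X (e i) ^ (l : ℕ)
  let f := algebraMap (MvPolynomial (Fin (p + 2)) k) (Qf k p)
  have hD : D.det ≠ 0 := fun h => hd (by
    rw [← coeff_det_sum_C_mul_X_pow A he d]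
    exact (congrArg _ h).trans (MvPolynomial.coeff_zero _))
  have hfD : (f.mapMatrix D).det ≠ 0 := by
    rw [← RingHom.map_det]
    exact (map_ne_zero_iff f (IsFractionRing.injective _ _)).mpr hD
  refine LinearIndependent.of_comp (LinearMap.funLeft (Qf k p) (Qf k p) e) ?_
  have hrow : (LinearMap.funLeft (Qf k p) (Qf k p) e ∘ fun j =>
      XQ k p n fun i => kToQ k p (b j i)) =
      (f.mapMatrix D).row := by
    ext j i
    simp [D, A, f, XQ, vandL, xvar, kToQ, Matrix.mulVec, dotProduct, mul_comm,
      MvPolynomial.algebraMap_eq]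
  rw [hrow]
  exact Matrix.linearIndependent_rows_of_det_ne_zero hfD

/-- For a `q`-dimensional subspace `V' ⊆ k^n` with `q ≤ n`, the map
`X : Q^n → Q^{p+2}` restricted to `V' ⊗_k Q` has rank `min (p+2) q`. -/
theorem XQ_rank_on_subspace
    {k : Type*} [Field k] (p : ℕ) {n q : ℕ} (hq : q ≤ n)
    (V' : Submodule k (Fin n → k)) (hV' : Module.finrank k ↥V' = q) :
    Module.finrank (Qf k p)
        ↥((Submodule.span (Qf k p)
              ((fun (v : Fin n → k) (i : Fin n) => kToQ k p (v i)) '' ↑V')).map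
            (XQ k p n)) = min (p + 2) q := by
  set g : (Fin n → k) → (Fin n → Qf k p) := fun v i => kToQ k p (v i) with hg
  set U := Submodule.span (Qf k p) (g '' ↑V')
  refine le_antisymm (le_min ?_ ?_) ?_
  · simpa using (U.map (XQ k p n)).finrank_le
  · refine (Submodule.finrank_map_le _ _).trans ?_
    let b := Module.finBasisOfFinrankEq k V' hV'
    have hle : U ≤ Submodule.span (Qf k p) (Set.range fun j => g (b j)) := by
      refine Submodule.span_le.mpr ?_
      rintro _ ⟨v, hv, rfl⟩
      have hsum : g v = ∑ j, kToQ k p (b.repr ⟨v, hv⟩ j) • g (b j) := by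
        have h := congrArg Subtype.val (b.sum_repr ⟨v, hv⟩)
        ext i
        rw [AddSubmonoidClass.coe_finsetSum] at h
        have hi := congrArg (kToQ k p) (congrFun h i)
        simpa [hg] using hi.symm
      rw [hsum]
      exact Submodule.sum_mem _ fun j _ =>
        Submodule.smul_mem _ _ (Submodule.subset_span ⟨j, rfl⟩)
    refine (Submodule.finrank_mono hle).trans ?_
    exact (finrank_range_le_card (R := Qf k p) fun j => g (b j)).trans_eq (Fintype.card_fin q)
  · obtain ⟨c, hc⟩ := exists_linearIndependent_of_le_finrank (R := k) (M := V')
      (n := min (p + 2) q) (hV' ▸ min_le_right _ _)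
    have hli := linearIndependent_XQ (p := p) (min_le_left _ _)
      (hc.map' V'.subtype V'.ker_subtype)
    have hmem : ∀ j, XQ k p n (g (c j)) ∈ U.map (XQ k p n) := fun j =>
      Submodule.mem_map_of_mem (Submodule.subset_span ⟨c j, (c j).2, rfl⟩)
    have hli' : LinearIndependent (Qf k p)
        (fun j => (⟨_, hmem j⟩ : U.map (XQ k p n))) :=
      LinearIndependent.of_comp (U.map (XQ k p n)).subtype hli
    simpa using hli'.fintype_card_le_finrank
end

section
/- Let 2 ≤ p ≤ n−2 and M = min{p, n−p} − 2. The number of triples (A,B,C), where A = {α_1,α_2,α_3,α_4} ⊂ {1,…,n}, B = {(β_1^0,β_1^1),…,(β_m^0,β_m^1)} with entries in {1,…,n} and 0 ≤ m ≤ M, C = {γ_1,…,γ_{p−m−2}} ⊂ {1,…,n}, all indices α_i, β_j^(μ), γ_l distinct, satisfying α_i < α_{i+1}, β_i^0 < β_i^1, β_i^ν < β_{i+1}^ν, β_i^0 < α_1, β_i^1 < α_3, γ_i < γ_{i+1}, equals Σ_{m=0}^{M} [n! / ((2m+4)! (p−m−2)! (n−p−m−2)!)] · (C_{m+2} − C_{m+1}),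 where C_r = (1/(r+1))·binom(2r, r) is the r-th Catalan number. -/
open ExteriorAlgebra

noncomputable section

variable (k : Type*) [Field k]

section LinearExtensions

open Classical in
/-- The `r`-increasing injective labellings of `S` with values below `n`, extended by `0`
outside `S`. -/
noncomputable def increasingLabellings {ι : Type*} [DecidableEq ι] (r : ι → ι → Prop)
    [DecidableRel r] : ℕ → Finset ι → Finset (ι → ℕ)
  | 0, S => if S = ∅ then {0} else ∅
  | n + 1, S => increasingLabellings r n S ∪
      (S.filter fun x => ∀ y ∈ S, ¬ r x y).biUnion fun x =>
        (increasingLabellings r n (S.erase x)).image fun h => Function.update h x n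

theorem mem_increasingLabellings {ι : Type*} [DecidableEq ι] {r : ι → ι → Prop}
    [DecidableRel r] {n : ℕ} {S : Finset ι} {h : ι → ℕ} :
    h ∈ increasingLabellings r n S ↔
      (∀ x ∈ S, h x < n) ∧ (∀ x ∉ S, h x = 0) ∧ (∀ x ∈ S, ∀ y ∈ S, h x = h y → x = y) ∧
        ∀ x ∈ S, ∀ y ∈ S, r x y → h x < h y := by
  classical
  induction n generalizing S h with
  | zero =>
    rw [increasingLabellings]
    split_ifs with hS
    · subst hS
      simp [funext_iff]
    · obtain ⟨x, hx⟩ := Finset.nonempty_iff_ne_empty.2 hS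
      simp only [Finset.notMem_empty, false_iff]
      exact fun H => absurd (H.1 x hx) (by simp)
  | succ n ih =>
    simp only [increasingLabellings, Finset.mem_union, Finset.mem_biUnion, Finset.mem_filter,
      Finset.mem_image, ih]
    constructor
    · rintro (⟨h1, h2, h3, h4⟩ | ⟨x, ⟨hx, hmax⟩, g, ⟨h1, h2, h3, h4⟩, rfl⟩)
      · exact ⟨fun x hx => (h1 x hx).trans n.lt_succ_self, h2, h3, h4⟩
      · have hlt : ∀ y ∈ S, y ≠ x → g y < n := fun y hy hyx =>
          h1 y (Finset.mem_erase.2 ⟨hyx, hy⟩)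
        refine ⟨fun y hy => ?_, fun y hy => ?_, fun y hy z hz hyz => ?_, fun y hy z hz hyz => ?_⟩
        · grind
        · grind
        · grind
        · grind
    · rintro ⟨h1, h2, h3, h4⟩
      by_cases hn : ∃ x ∈ S, h x = n
      · obtain ⟨x, hx, hxn⟩ := hn
        refine Or.inr ⟨x, ⟨hx, fun y hy hxy => ?_⟩, Function.update h x 0,
          ⟨fun y hy => ?_, fun y hy => ?_, fun y hy z hz hyz => ?_, fun y hy z hz hyz => ?_⟩, ?_⟩
        · have := h1 y hy
          have := h4 x hx y hy hxy
          omega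
        · have hy' := Finset.mem_erase.1 hy
          have := h1 y hy'.2
          have : h y ≠ n := fun e => hy'.1 (h3 y hy'.2 x hx (e.trans hxn.symm))
          rw [Function.update_of_ne hy'.1]
          omega
        · grind
        · grind
        · grind
        · rw [Function.update_idem, ← hxn, Function.update_eq_self]
      · push Not at hn
        exact Or.inl ⟨fun x hx => lt_of_le_of_ne (Nat.lt_succ_iff.1 (h1 x hx)) (hn x hx),
          h2, h3, h4⟩

theorem card_increasingLabellings_succ {ι : Type*} [DecidableEq ι] (r : ι → ι → Prop)
    [DecidableRel r] (n : ℕ) (S : Finset ι) :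
    (increasingLabellings r (n + 1) S).card = (increasingLabellings r n S).card +
      ∑ x ∈ S, if ∀ y ∈ S, ¬ r x y then (increasingLabellings r n (S.erase x)).card else 0 := by
  classical
  rw [increasingLabellings, Finset.card_union_of_disjoint, Finset.card_biUnion,
    Finset.sum_filter]
  · congr 1
    refine Finset.sum_congr rfl fun x hx => ?_
    split_ifs
    · refine Finset.card_image_of_injOn fun g hg g' hg' h => ?_
      rw [Finset.mem_coe, mem_increasingLabellings] at hg hg'
      funext y
      by_cases hy : y = x
      · rw [hy, hg.2.1 x (by simp), hg'.2.1 x (by simp)]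
      · simpa [hy] using congrFun h y
    · rfl
  · intro x hx x' hx' hne
    rw [Function.onFun, Finset.disjoint_left]
    intro g hg hg'
    obtain ⟨f, hf, rfl⟩ := Finset.mem_image.1 hg
    obtain ⟨f', hf', h⟩ := Finset.mem_image.1 hg'
    have := (mem_increasingLabellings.1 hf').1 x
      (Finset.mem_erase.2 ⟨hne, (Finset.mem_filter.1 hx).1⟩)
    have h' := congrFun h x
    simp [hne] at h'
    omega
  · rw [Finset.disjoint_left]
    intro g hg hg'
    obtain ⟨x, hx, hg'⟩ := Finset.mem_biUnion.1 hg'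
    obtain ⟨f, hf, rfl⟩ := Finset.mem_image.1 hg'
    have := (mem_increasingLabellings.1 hg).1 x (Finset.mem_filter.1 hx).1
    simp at this

/-- Increasing labellings of the image of an embedding are increasing injections. -/
theorem card_injective_increasing {ι J : Type*} [DecidableEq ι] [Fintype J] (r : ι → ι → Prop)
    [DecidableRel r] (n : ℕ) {e : J → ι} (he : Function.Injective e) :
    Nat.card {k : J → Fin n // Function.Injective k ∧ ∀ i j, r (e i) (e j) → k i < k j} =
      (increasingLabellings r n (Finset.univ.image e)).card := by
  have hmem : ∀ j, e j ∈ Finset.univ.image e := fun j =>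
    Finset.mem_image_of_mem _ (Finset.mem_univ j)
  rw [← Fintype.card_coe, ← Nat.card_eq_fintype_card]
  refine Nat.card_congr ⟨fun k => ⟨Function.extend e (fun j => (k.1 j : ℕ)) 0, ?_⟩,
    fun h => ⟨fun j => ⟨h.1 (e j), (mem_increasingLabellings.1 h.2).1 _ (hmem j)⟩, ?_, ?_⟩,
    ?_, ?_⟩
  · obtain ⟨k, hk, hr⟩ := k
    rw [mem_increasingLabellings]
    simp only [Finset.mem_image, Finset.mem_univ, true_and, forall_exists_index,
      forall_apply_eq_imp_iff, he.extend_apply]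
    refine ⟨fun j => (k j).2, fun x hx => ?_, fun i j hij => ?_, fun i j hij => hr i j hij⟩
    · rw [Function.extend_apply' _ _ _ hx, Pi.zero_apply]
    · rw [hk (Fin.ext hij)]
  · intro i j hij
    exact he ((mem_increasingLabellings.1 h.2).2.2.1 _ (hmem i) _ (hmem j) (Fin.ext_iff.1 hij))
  · intro i j hij
    exact (mem_increasingLabellings.1 h.2).2.2.2 _ (hmem i) _ (hmem j) hij
  · intro k
    ext j
    simp [he.extend_apply]
  · intro h
    ext x
    by_cases hx : ∃ j, e j = x
    · obtain ⟨j, rfl⟩ := hx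
      simp [he.extend_apply]
    · have h0 := (mem_increasingLabellings.1 h.2).2.1 x (by simpa using hx)
      simp [Function.extend_apply' _ _ _ hx, h0]

end LinearExtensions

section TwoRows

/-- Three chains, indexed by `ℕ ⊕ ℕ ⊕ ℕ`; the first two form the rows of a tableau increasing
along columns, with the entry `m + 1` of the first row also below the entry `m` of the second. -/
def rowRel (m : ℕ) : ℕ ⊕ ℕ ⊕ ℕ → ℕ ⊕ ℕ ⊕ ℕ → Prop
  | .inl i, .inl j => i < j
  | .inl i, .inr (.inl j) => i ≤ j ∨ (i = m + 1 ∧ j = m)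
  | .inr (.inl i), .inr (.inl j) => i < j
  | .inr (.inr i), .inr (.inr j) => i < j
  | _, _ => False

/-- The initial segments of lengths `a`, `b`, `c` of the three chains. -/
def rowSet (a b c : ℕ) : Finset (ℕ ⊕ ℕ ⊕ ℕ) :=
  (Finset.range a).disjSum ((Finset.range b).disjSum (Finset.range c))

/-- The number of linear extensions of the first two rows of `rowRel m`, cut at `a` and `b`. -/
def rowCount (m : ℕ) : ℕ → ℕ → ℕ
  | 0, 0 => 1
  | 0, b + 1 => rowCount m 0 b
  | a + 1, 0 => rowCount m a 0
  | a + 1, b + 1 => (if b + 1 ≤ a ∧ ¬ (a = m + 1 ∧ m < b + 1) then rowCount m a (b + 1) else 0) +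
      rowCount m (a + 1) b

@[simp] theorem inl_mem_rowSet {a b c i : ℕ} : .inl i ∈ rowSet a b c ↔ i < a := by
  simp [rowSet]

@[simp] theorem inr_inl_mem_rowSet {a b c i : ℕ} :
    .inr (.inl i) ∈ rowSet a b c ↔ i < b := by
  simp [rowSet]

@[simp] theorem inr_inr_mem_rowSet {a b c i : ℕ} :
    .inr (.inr i) ∈ rowSet a b c ↔ i < c := by
  simp [rowSet]

theorem rowSet_erase_inl (a b c : ℕ) [DecidableEq (ℕ ⊕ ℕ ⊕ ℕ)] :
    (rowSet (a + 1) b c).erase (.inl a) = rowSet a b c := by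
  ext (i | i | i) <;> simp; omega

theorem rowSet_erase_inr_inl (a b c : ℕ) [DecidableEq (ℕ ⊕ ℕ ⊕ ℕ)] :
    (rowSet a (b + 1) c).erase (.inr (.inl b)) = rowSet a b c := by
  ext (i | i | i) <;> simp; omega

theorem rowSet_erase_inr_inr (a b c : ℕ) [DecidableEq (ℕ ⊕ ℕ ⊕ ℕ)] :
    (rowSet a b (c + 1)).erase (.inr (.inr c)) = rowSet a b c := by
  ext (i | i | i) <;> simp; omega

theorem maximal_inl_iff {m a b c i : ℕ} :
    (∀ y ∈ rowSet (a + 1) b c, ¬ rowRel m (.inl i) y) ↔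
      a ≤ i ∧ b ≤ i ∧ ¬ (i = m + 1 ∧ m < b) := by
  simp only [Sum.forall, inl_mem_rowSet, inr_inl_mem_rowSet, inr_inr_mem_rowSet, rowRel]
  constructor
  · rintro ⟨h1, h2, -⟩
    refine ⟨?_, ?_, ?_⟩
    · by_contra! h
      exact h1 a (by omega) h
    · by_contra! h
      exact h2 i h (Or.inl le_rfl)
    · rintro ⟨h, h'⟩
      exact h2 m h' (Or.inr ⟨h, rfl⟩)
  · rintro ⟨h1, h2, h3⟩
    refine ⟨fun j hj => ?_, fun j hj => ?_, fun _ _ h => h⟩ <;> omega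

theorem maximal_inr_inl_iff {m a b c i : ℕ} :
    (∀ y ∈ rowSet a (b + 1) c, ¬ rowRel m (.inr (.inl i)) y) ↔ b ≤ i := by
  simp only [Sum.forall, inl_mem_rowSet, inr_inl_mem_rowSet, inr_inr_mem_rowSet, rowRel]
  constructor
  · rintro ⟨-, h2, -⟩
    by_contra! h
    exact h2 b (by omega) h
  · intro h
    refine ⟨fun _ _ h => h, fun j hj => ?_, fun _ _ h => h⟩
    omega

theorem maximal_inr_inr_iff {m a b c i : ℕ} :
    (∀ y ∈ rowSet a b (c + 1), ¬ rowRel m (.inr (.inr i)) y) ↔ c ≤ i := by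
  simp only [Sum.forall, inl_mem_rowSet, inr_inl_mem_rowSet, inr_inr_mem_rowSet, rowRel]
  constructor
  · rintro ⟨-, -, h2⟩
    by_contra! h
    exact h2 c (by omega) h
  · intro h
    refine ⟨fun _ _ h => h, fun _ _ h => h, fun j hj => ?_⟩
    omega

open Classical in
theorem card_increasingLabellings_rowSet (m n a b c : ℕ) :
    (increasingLabellings (rowRel m) n (rowSet a b c)).card =
      n.choose (a + b + c) * (a + b + c).choose c * rowCount m a b := by
  induction n generalizing a b c with
  | zero =>
    rw [increasingLabellings]
    split_ifs with h
    · have ha : a = 0 := by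
        by_contra h0
        simpa [h] using (inl_mem_rowSet (a := a) (b := b) (c := c) (i := 0)).2 (by omega)
      have hb : b = 0 := by
        by_contra h0
        simpa [h] using (inr_inl_mem_rowSet (a := a) (b := b) (c := c) (i := 0)).2 (by omega)
      have hc : c = 0 := by
        by_contra h0
        simpa [h] using (inr_inr_mem_rowSet (a := a) (b := b) (c := c) (i := 0)).2 (by omega)
      subst ha hb hc
      simp [rowCount]
    · have : a + b + c ≠ 0 := by
        intro h0
        obtain ⟨⟨rfl, rfl⟩, rfl⟩ : (a = 0 ∧ b = 0) ∧ c = 0 := by omega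
        exact h (by ext (i | i | i) <;> simp)
      rw [Finset.card_empty, Nat.choose_eq_zero_of_lt (by omega)]
      simp
  | succ n ih =>
    have hA : (∑ i ∈ Finset.range a, if ∀ y ∈ rowSet a b c, ¬ rowRel m (.inl i) y then
          (increasingLabellings (rowRel m) n ((rowSet a b c).erase (.inl i))).card else 0) =
        match a with
        | 0 => 0
        | a + 1 => if b ≤ a ∧ ¬ (a = m + 1 ∧ m < b) then
          n.choose (a + b + c) * (a + b + c).choose c * rowCount m a b else 0 := by
      rcases a with _ | a
      · simp
      · rw [Finset.sum_range_succ, Finset.sum_eq_zero, zero_add, rowSet_erase_inl, ih]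
        · simp only [maximal_inl_iff, le_refl, true_and]
        · intro i hi
          rw [Finset.mem_range] at hi
          rw [if_neg]
          rw [maximal_inl_iff]
          omega
    have hB : (∑ i ∈ Finset.range b, if ∀ y ∈ rowSet a b c, ¬ rowRel m (.inr (.inl i)) y then
          (increasingLabellings (rowRel m) n ((rowSet a b c).erase (.inr (.inl i)))).card else 0) =
        match b with
        | 0 => 0
        | b + 1 => n.choose (a + b + c) * (a + b + c).choose c * rowCount m a b := by
      rcases b with _ | b
      · simp
      · rw [Finset.sum_range_succ, Finset.sum_eq_zero, zero_add, rowSet_erase_inr_inl, ih]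
        · simp only [maximal_inr_inl_iff, le_refl, if_true]
        · intro i hi
          rw [Finset.mem_range] at hi
          rw [if_neg]
          rw [maximal_inr_inl_iff]
          omega
    have hC : (∑ i ∈ Finset.range c, if ∀ y ∈ rowSet a b c, ¬ rowRel m (.inr (.inr i)) y then
          (increasingLabellings (rowRel m) n ((rowSet a b c).erase (.inr (.inr i)))).card else 0) =
        match c with
        | 0 => 0
        | c + 1 => n.choose (a + b + c) * (a + b + c).choose c * rowCount m a b := by
      rcases c with _ | c
      · simp
      · rw [Finset.sum_range_succ, Finset.sum_eq_zero, zero_add, rowSet_erase_inr_inr, ih]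
        · simp only [maximal_inr_inr_iff, le_refl, if_true]
        · intro i hi
          rw [Finset.mem_range] at hi
          rw [if_neg]
          rw [maximal_inr_inr_iff]
          omega
    have hsum : ∀ f : ℕ ⊕ ℕ ⊕ ℕ → ℕ, ∑ x ∈ rowSet a b c, f x =
        ∑ i ∈ Finset.range a, f (.inl i) + (∑ i ∈ Finset.range b, f (.inr (.inl i)) +
          ∑ i ∈ Finset.range c, f (.inr (.inr i))) := fun f => by
      rw [rowSet, Finset.sum_disjSum, Finset.sum_disjSum]
    rw [card_increasingLabellings_succ, hsum, hA, hB, hC, ih]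
    have pascal : ∀ N c, (n + 1).choose (N + 1 + c) * (N + 1 + c).choose c =
        n.choose (N + 1 + c) * (N + 1 + c).choose c + n.choose (N + c) * (N + c).choose c +
          (match c with
          | 0 => 0
          | c + 1 => n.choose (N + 1 + c) * (N + 1 + c).choose c) := by
      intro N c
      rcases c with _ | c
      · simp [Nat.choose_succ_succ]
        ring
      · have e1 : N + 1 + (c + 1) = (N + c + 1) + 1 := by ring
        have e2 : N + (c + 1) = N + c + 1 := by ring
        have e3 : N + 1 + c = N + c + 1 := by ring
        simp only [e1, e2, e3]
        rw [Nat.choose_succ_succ n, Nat.choose_succ_succ (N + c + 1) c]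
        ring
    rcases a with _ | a <;> rcases b with _ | b
    · rcases c with _ | c
      · simp
      · simp [rowCount, Nat.choose_succ_succ n c]
        ring
    · have := pascal b c
      simp only [zero_add] at this ⊢
      rw [this]
      rcases c with _ | c <;> simp only [rowCount] <;> ring
    · have := pascal a c
      simp only [add_zero] at this ⊢
      rw [this]
      rcases c with _ | c <;> simp [rowCount] <;> ring
    · have := pascal (a + b + 1) c
      have e1 : a + 1 + (b + 1) = a + b + 1 + 1 := by ring
      have e2 : a + (b + 1) = a + b + 1 := by ring
      have e3 : a + 1 + b = a + b + 1 := by ring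
      simp only [e1, e2, e3]
      rw [this]
      simp only [rowCount]
      rcases c with _ | c <;> split_ifs <;> ring

theorem rowCount_add_choose {m a b : ℕ} (hba : b ≤ a) (hbm : b ≤ m) :
    rowCount m a b + (a + b).choose (a + 1) = (a + b).choose a := by
  induction a generalizing b with
  | zero =>
    obtain rfl : b = 0 := by omega
    simp [rowCount]
  | succ a iha =>
    induction b with
    | zero =>
      have := iha (b := 0) (by omega) (by omega)
      simp at this
      simp [rowCount, this]
    | succ b ihb =>
      have h1 := ihb (by omega) (by omega)
      rw [rowCount]
      have e : a + 1 + (b + 1) = (a + b + 1) + 1 := by ring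
      have e3 : a + 1 + b = a + b + 1 := by ring
      rw [e, Nat.choose_succ_succ, Nat.choose_succ_succ (a + b + 1) a]
      rw [e3] at h1
      split_ifs with h
      · have h2 := iha (b := b + 1) h.1 hbm
        rw [← add_assoc] at h2
        simp only [Nat.succ_eq_add_one] at *
        omega
      · obtain rfl : a = b := by omega
        have h2 := Nat.choose_symm_half a
        rw [show 2 * a + 1 = a + a + 1 by ring] at h2
        simp only [Nat.succ_eq_add_one] at *
        omega

theorem catalan_add_choose (r : ℕ) :
    catalan r + (2 * r).choose (r + 1) = (2 * r).choose r := by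
  have h1 := succ_mul_catalan_eq_centralBinom r
  have h2 := Nat.choose_succ_right_eq (2 * r) r
  rw [Nat.centralBinom_eq_two_mul_choose] at h1
  rw [show 2 * r - r = r by omega] at h2
  refine Nat.eq_of_mul_eq_mul_left r.succ_pos ?_
  simp only [Nat.succ_eq_add_one]
  linarith

theorem rowCount_eq_catalan_sub (m : ℕ) :
    rowCount m (m + 2) (m + 2) = catalan (m + 2) - catalan (m + 1) := by
  have h0 : rowCount m (m + 2) (m + 2) = rowCount m (m + 2) m := by
    rw [rowCount, if_neg (by omega), rowCount, if_neg (by omega), zero_add, zero_add]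
  have h1 := rowCount_add_choose (m := m) (a := m + 2) (b := m) (by omega) le_rfl
  have h2 := catalan_add_choose (m + 2)
  have h3 := catalan_add_choose (m + 1)
  have h4 : (2 * m + 2).choose m = (2 * m + 2).choose (m + 2) :=
    Nat.choose_symm_of_eq_add (by ring)
  rw [show m + 2 + m = 2 * m + 2 by ring] at h1
  rw [show 2 * (m + 2) = 2 * m + 2 + 1 + 1 by ring] at h2
  rw [show 2 * (m + 1) = 2 * m + 2 by ring] at h3
  have pascal : ∀ N k, (N + 1 + 1).choose (k + 2) =
      N.choose k + 2 * N.choose (k + 1) + N.choose (k + 2) := fun N k => by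
    simp only [Nat.choose_succ_succ']
    ring
  have h5 := pascal (2 * m + 2) m
  have h6 := pascal (2 * m + 2) (m + 1)
  simp only [add_assoc, Nat.reduceAdd] at h1 h2 h3 h4 h5 h6
  omega

end TwoRows

section OrderedTriples

/-- The cell of the three chains holding each of the indices `α_i`, `β_l^ν`, `γ_l`. -/
def tripleCell (m c : ℕ) : Fin 4 ⊕ (Fin m × Fin 2) ⊕ Fin c → ℕ ⊕ ℕ ⊕ ℕ :=
  Sum.elim ![.inl m, .inl (m + 1), .inr (.inl m), .inr (.inl (m + 1))]
    (Sum.elim (fun x => ![.inl (x.1 : ℕ), .inr (.inl (x.1 : ℕ))] x.2)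
      (fun l => .inr (.inr (l : ℕ))))

theorem tripleCell_injective (m c : ℕ) : Function.Injective (tripleCell m c) := by
  rintro (i | ⟨l, ν⟩ | l) (j | ⟨l', ν'⟩ | l') h
  · fin_cases i <;> fin_cases j <;> simp [tripleCell] at h ⊢
  · fin_cases i <;> fin_cases ν' <;> simp [tripleCell] at h <;> omega
  · fin_cases i <;> simp [tripleCell] at h
  · fin_cases j <;> fin_cases ν <;> simp [tripleCell] at h <;> omega
  · fin_cases ν <;> fin_cases ν' <;> simp [tripleCell] at h ⊢ <;> omega
  · fin_cases ν <;> simp [tripleCell] at h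
  · fin_cases j <;> simp [tripleCell] at h
  · fin_cases ν' <;> simp [tripleCell] at h
  · simp [tripleCell] at h ⊢
    omega

theorem image_tripleCell (m c : ℕ) [DecidableEq (ℕ ⊕ ℕ ⊕ ℕ)] :
    Finset.univ.image (tripleCell m c) = rowSet (m + 2) (m + 2) c := by
  ext x
  simp only [Finset.mem_image, Finset.mem_univ, true_and]
  constructor
  · rintro ⟨i | ⟨l, ν⟩ | l, rfl⟩
    · fin_cases i <;> simp [tripleCell]
    · fin_cases ν <;> simp [tripleCell] <;> omega
    · simp [tripleCell]
  · rcases x with i | i | i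
    · rw [inl_mem_rowSet]
      intro h
      obtain h | rfl | rfl : i < m ∨ i = m ∨ i = m + 1 := by omega
      · exact ⟨.inr (.inl (⟨i, h⟩, 0)), rfl⟩
      · exact ⟨.inl 0, rfl⟩
      · exact ⟨.inl 1, rfl⟩
    · rw [inr_inl_mem_rowSet]
      intro h
      obtain h | rfl | rfl : i < m ∨ i = m ∨ i = m + 1 := by omega
      · exact ⟨.inr (.inl (⟨i, h⟩, 1)), rfl⟩
      · exact ⟨.inl 2, rfl⟩
      · exact ⟨.inl 3, rfl⟩
    · rw [inr_inr_mem_rowSet]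
      exact fun h => ⟨.inr (.inr ⟨i, h⟩), rfl⟩

theorem orderedABC_iff {n m c : ℕ} {α : Fin 4 → Fin n} {β : Fin m → Fin 2 → Fin n}
    {γ : Fin c → Fin n} {k : Fin 4 ⊕ (Fin m × Fin 2) ⊕ Fin c → Fin n}
    (hk : k = Sum.elim α (Sum.elim (fun x : Fin m × Fin 2 => β x.1 x.2) γ)) :
    OrderedABC m c α β γ ↔ Function.Injective k ∧
      ∀ i j, rowRel m (tripleCell m c i) (tripleCell m c j) → k i < k j := by
  subst hk
  refine and_congr_right fun _ => ⟨?_, fun h => ⟨?_, ?_, ?_, ?_, ?_, ?_⟩⟩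
  · rintro ⟨hα, hβ, hβ', h0, h1, hγ⟩
    have a01 : α 0 < α 1 := hα (by decide)
    have a12 : α 1 < α 2 := hα (by decide)
    have a23 : α 2 < α 3 := hα (by decide)
    have hβ01 : ∀ l l', l ≤ l' → β l 0 < β l' 1 := fun l l' hl =>
      ((hβ' 0).monotone hl).trans_lt (hβ l')
    rintro (i | ⟨l, ν⟩ | l) (j | ⟨l', ν'⟩ | l') h
    · fin_cases i <;> fin_cases j <;> simp [tripleCell, rowRel] at h ⊢ <;> order
    · fin_cases i <;> fin_cases ν' <;> simp [tripleCell, rowRel] at h <;> omega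
    · fin_cases i <;> simp [tripleCell, rowRel] at h
    · have := h0 l
      have := h1 l
      fin_cases j <;> fin_cases ν <;> simp [tripleCell, rowRel] at h ⊢ <;> order
    · fin_cases ν <;> fin_cases ν' <;> simp [tripleCell, rowRel] at h ⊢
      · exact hβ' 0 h
      · exact hβ01 _ _ (by omega)
      · exact hβ' 1 h
    · fin_cases ν <;> simp [tripleCell, rowRel] at h
    · fin_cases j <;> simp [tripleCell, rowRel] at h
    · fin_cases ν' <;> simp [tripleCell, rowRel] at h
    · exact hγ h
  · refine Fin.strictMono_iff_lt_succ.2 fun i => ?_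
    fin_cases i
    · exact h (.inl 0) (.inl 1) (by simp [tripleCell, rowRel])
    · exact h (.inl 1) (.inl 2) (by simp [tripleCell, rowRel])
    · exact h (.inl 2) (.inl 3) (by simp [tripleCell, rowRel])
  · exact fun l => h (.inr (.inl (l, 0))) (.inr (.inl (l, 1))) (by simp [tripleCell, rowRel])
  · intro ν l l' hl
    refine h (.inr (.inl (l, ν))) (.inr (.inl (l', ν))) ?_
    fin_cases ν <;> simpa [tripleCell, rowRel] using hl
  · exact fun l => h (.inr (.inl (l, 0))) (.inl 0) (by simp [tripleCell, rowRel])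
  · exact fun l => h (.inr (.inl (l, 1))) (.inl 2) (by simp [tripleCell, rowRel])
  · exact fun l l' hl => h (.inr (.inr l)) (.inr (.inr l')) hl

theorem card_orderedABC (n m c : ℕ) :
    Nat.card {x : (Fin 4 → Fin n) × (Fin m → Fin 2 → Fin n) × (Fin c → Fin n) //
        OrderedABC m c x.1 x.2.1 x.2.2} =
      n.choose (2 * m + 4 + c) * (2 * m + 4 + c).choose c *
        (catalan (m + 2) - catalan (m + 1)) := by
  classical
  have hc := card_increasingLabellings_rowSet m n (m + 2) (m + 2) c
  rw [← image_tripleCell, ← card_injective_increasing _ _ (tripleCell_injective m c),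
    rowCount_eq_catalan_sub, show m + 2 + (m + 2) + c = 2 * m + 4 + c by ring] at hc
  rw [← hc]
  refine Nat.card_congr (Equiv.subtypeEquiv
    (((Equiv.refl _).prodCongr (((Equiv.curry _ _ _).symm.prodCongr (Equiv.refl _)).trans
      (Equiv.sumArrowEquivProdArrow _ _ _).symm)).trans
        (Equiv.sumArrowEquivProdArrow _ _ _).symm) fun x => orderedABC_iff rfl)

theorem choose_mul_choose_eq_factorial_div (N c d : ℕ) :
    (N + c + d).choose (N + c) * (N + c).choose c =
      (N + c + d).factorial / (N.factorial * c.factorial * d.factorial) := by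
  refine (Nat.div_eq_of_eq_mul_left (by positivity) ?_).symm
  rw [← Nat.add_choose_mul_factorial_mul_factorial (N + c) d,
    ← Nat.add_choose_mul_factorial_mul_factorial N c, Nat.choose_symm_add (a := N + c) (b := d)]
  ring

end OrderedTriples

/-- The number of ordered triples `(A,B,C)` (over all `0 ≤ m ≤ M`,
`M = min p (n-p) - 2`) equals
`Σ_{m=0}^{M} n!/((2m+4)!(p−m−2)!(n−p−m−2)!) · (C_{m+2} − C_{m+1})`. -/
theorem card_ordered_triples
    {p n : ℕ} (hp : 2 ≤ p) (hpn : p ≤ n - 2) :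
    Nat.card ((m : Fin (min p (n - p) - 2 + 1)) ×
        {x : (Fin 4 → Fin n) × (Fin (m : ℕ) → Fin 2 → Fin n) ×
              (Fin (p - (m : ℕ) - 2) → Fin n) //
          OrderedABC (m : ℕ) (p - (m : ℕ) - 2) x.1 x.2.1 x.2.2}) =
      ∑ m ∈ Finset.range (min p (n - p) - 2 + 1),
        n.factorial /
            ((2 * m + 4).factorial * (p - m - 2).factorial * (n - p - m - 2).factorial) *
          (catalan (m + 2) - catalan (m + 1)) := by
  rw [Nat.card_sigma, ← Fin.sum_univ_eq_sum_range fun m =>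
    n.factorial /
        ((2 * m + 4).factorial * (p - m - 2).factorial * (n - p - m - 2).factorial) *
      (catalan (m + 2) - catalan (m + 1))]
  refine Finset.sum_congr rfl fun m _ => ?_
  have hn : n = 2 * (m : ℕ) + 4 + (p - m - 2) + (n - p - m - 2) := by omega
  rw [card_orderedABC]
  congr 1
  have h := choose_mul_choose_eq_factorial_div (2 * (m : ℕ) + 4) (p - m - 2) (n - p - m - 2)
  rwa [← hn] at h

end
end

section
/- Let ν_0, ν_1, ν_2, α_1, α_2, α_3 be distinct elements of {1,…,n}, let B = {β⃗_1,…,β⃗_m} be a set of 2-vectors in {1,…,n}^2 and C a subset of {1,…,n} with |C| = p−m−3. Then, with indices i read modulo 3, the identity Σ_{i∈ℤ/3ℤ} P'_{(ν_i,α_1,α_2,α_3), B∪{(ν_{i+1},ν_{i+2})}, C}(ω) − Σ_{0≤i,j≤2, i≠j} P'_{(ν_i,α_1,α_2,α_3), B, C∪{ν_j}}(ω) = 0 holds for all ω ∈ ⋀^p k^n. -/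
open ExteriorAlgebra

noncomputable section

variable (k : Type*) [Field k]

/-- Permuting the index tuple multiplies the coordinate by the sign of the permutation. -/
theorem coordF_comp_perm {n q : ℕ} (σ : Equiv.Perm (Fin q)) (idx : Fin q → Fin n) :
    coordF k q (idx ∘ σ) = ((Equiv.Perm.sign σ : ℤ) : k) • coordF k q idx := by
  have hA : coordA k q (idx ∘ σ) = ((Equiv.Perm.sign σ : ℤ) : k) • coordA k q idx := by
    ext v
    exact Matrix.det_permute' σ (Matrix.of fun i j => v i (idx j))
  have hU : Function.update (fun i => (0 : (Fin n → k) [⋀^Fin i]→ₗ[k] k)) q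
        (coordA k q (idx ∘ σ)) =
      ((Equiv.Perm.sign σ : ℤ) : k) •
        Function.update (fun i => (0 : (Fin n → k) [⋀^Fin i]→ₗ[k] k)) q (coordA k q idx) := by
    rw [hA, ← Function.update_smul]
    congr 1
    ext
    simp
  rw [coordF, hU, coordF]
  exact map_smul (ExteriorAlgebra.liftAlternating (R := k) (M := Fin n → k) (N := k)) _ _

/-- Reindexing the index tuple along a bijection changes the coordinate by a sign. -/
theorem exists_sign_coordF_comp {n q q' : ℕ} (e : Fin q ≃ Fin q') :
    ∃ s : k, s * s = 1 ∧ ∀ idx : Fin q' → Fin n,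
      coordF k q (idx ∘ e) = s • coordF k q' idx := by
  obtain rfl : q = q' := by simpa using Fintype.card_congr e
  refine ⟨((Equiv.Perm.sign e : ℤ) : k), ?_, coordF_comp_perm k e⟩
  rw [← Int.cast_mul, Int.units_coe_mul_self, Int.cast_one]

/-- Transposing two entries of the index tuple negates the coordinate. -/
theorem coordF_comp_swap {n q : ℕ} {i j : Fin q} (hij : i ≠ j) (idx : Fin q → Fin n) :
    coordF k q (idx ∘ Equiv.swap i j) = -coordF k q idx := by
  refine LinearMap.ext fun x => ?_
  simp [coordF_comp_perm, Equiv.Perm.sign_swap hij]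

/-- The bijection of positions moving the last position of the middle block to the very end. -/
def moveLastEquiv (m c : ℕ) : Fin (2 + (m + 1 + c)) ≃ Fin (2 + (m + (c + 1))) :=
  finSumFinEquiv.symm.trans <|
    (Equiv.sumCongr (Equiv.refl (Fin 2)) <|
      finSumFinEquiv.symm.trans <|
        (Equiv.sumCongr finSumFinEquiv.symm (Equiv.refl (Fin c))).trans <|
          (Equiv.sumAssoc (Fin m) (Fin 1) (Fin c)).trans <|
            (Equiv.sumCongr (Equiv.refl (Fin m))
              ((Equiv.sumComm (Fin 1) (Fin c)).trans finSumFinEquiv)).trans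
              finSumFinEquiv).trans
      finSumFinEquiv

theorem append_snoc_eq_comp_moveLastEquiv {X : Type*} {m c : ℕ} (a : Fin 2 → X) (b : Fin m → X)
    (g : Fin c → X) (x : X) :
    Fin.append a (Fin.append (Fin.snoc b x : Fin (m + 1) → X) g) =
      Fin.append a (Fin.append b (Fin.snoc g x : Fin (c + 1) → X)) ∘ moveLastEquiv m c := by
  rw [show Fin.snoc b x = Fin.append b ![x] from (Fin.append_right_eq_snoc b ![x]).symm,
    show Fin.snoc g x = Fin.append g ![x] from (Fin.append_right_eq_snoc g ![x]).symm]
  ext i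
  induction i using Fin.addCases with
  | left i => simp [moveLastEquiv]
  | right i =>
    induction i using Fin.addCases with
    | left i =>
      induction i using Fin.addCases with
      | left i => simp [moveLastEquiv]
      | right i => simp [moveLastEquiv]
    | right i => simp [moveLastEquiv]

/-- The coordinate with index tuple `(x, y, β⃗_1, …, β⃗_m, γ_1, …, γ_c, z)`. -/
def tripleF {n m c : ℕ} (β : Fin m → Fin 2 → Fin n) (γ : Fin c → Fin n) (x y z : Fin n) :
    ExteriorAlgebra k (Fin n → k) →ₗ[k] k :=
  ∑ ε : Fin m → Fin 2, coordF k (2 + (m + (c + 1)))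
    (Fin.append ![x, y] (Fin.append (fun l => β l (ε l)) (Fin.snoc γ z : Fin (c + 1) → Fin n)))

theorem tripleF_swap {n m c : ℕ} (β : Fin m → Fin 2 → Fin n) (γ : Fin c → Fin n)
    (x y z : Fin n) : tripleF k β γ z y x = -tripleF k β γ x y z := by
  have hne : Fin.castAdd (m + (c + 1)) (0 : Fin 2) ≠
      Fin.natAdd 2 (Fin.natAdd m (Fin.last c)) := by
    simp [Fin.ext_iff]
    omega
  rw [tripleF, tripleF, ← Finset.sum_neg_distrib]
  refine Finset.sum_congr rfl fun ε _ => ?_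
  rw [← coordF_comp_swap k hne]
  congr 1
  ext i : 1
  rw [Function.comp_apply]
  induction i using Fin.addCases with
  | left i =>
    fin_cases i
    · refine Eq.trans ?_ (congrArg _ (Equiv.swap_apply_left _ _).symm)
      rw [Fin.append_right, Fin.append_right, Fin.snoc_last]
      rfl
    · rw [Equiv.swap_apply_of_ne_of_ne] <;> simp [Fin.ext_iff]
      omega
  | right i =>
    induction i using Fin.addCases with
    | left i => rw [Equiv.swap_apply_of_ne_of_ne] <;> simp [Fin.ext_iff]; omega
    | right i =>
      induction i using Fin.lastCases with
      | last =>
        rw [Equiv.swap_apply_right, Fin.append_left, Fin.append_right, Fin.append_right,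
          Fin.snoc_last]
        rfl
      | cast i => rw [Equiv.swap_apply_of_ne_of_ne] <;> simp [Fin.ext_iff]; omega

/-- Adjoining a 2-vector `(u, v)` to `B` amounts, up to a common sign, to adding the results of
adjoining `u` and `v` to `C`. -/
theorem exists_sign_piF_snoc (n m c : ℕ) :
    ∃ s : k, s * s = 1 ∧ ∀ (a : Fin 4 → Fin n) (β : Fin m → Fin 2 → Fin n) (γ : Fin c → Fin n)
      (u v : Fin n) (i j : Fin 4),
      piF k (m + 1) c a (Fin.snoc β ![u, v]) γ i j =
        s • (tripleF k β γ (a i) (a j) u + tripleF k β γ (a i) (a j) v) := by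
  obtain ⟨s, hs, h⟩ := exists_sign_coordF_comp k (n := n) (moveLastEquiv m c)
  refine ⟨s, hs, fun a β γ u v i j => ?_⟩
  have hsnoc (t : Fin 2) (ε : Fin m → Fin 2) :
      (fun l => (Fin.snoc β ![u, v] : Fin (m + 1) → Fin 2 → Fin n) l
        ((Fin.snoc ε t : Fin (m + 1) → Fin 2) l)) =
      (Fin.snoc (fun l => β l (ε l)) (![u, v] t) : Fin (m + 1) → Fin n) := by
    ext l : 1
    induction l using Fin.lastCases <;> simp
  rw [piF, ← (Fin.snocEquiv fun _ => Fin 2).sum_comp, Fintype.sum_prod_type, Fin.sum_univ_two,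
    smul_add, tripleF, tripleF, Finset.smul_sum, Finset.smul_sum]
  congr 1 <;> refine Finset.sum_congr rfl fun ε _ => ?_ <;>
  · rw [← h, ← append_snoc_eq_comp_moveLastEquiv, tupleP]
    exact congrArg (fun b => coordF k _ (Fin.append _ (Fin.append b γ))) (hsnoc _ ε)

/-- The cyclic linear relation among the forms `P'`:
`Σ_{i ∈ ℤ/3} P'_{(ν_i,α₁,α₂,α₃), B ∪ {(ν_{i+1},ν_{i+2})}, C}
 − Σ_{i ≠ j} P'_{(ν_i,α₁,α₂,α₃), B, C ∪ {ν_j}} = 0`. -/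
theorem Pprime_cyclic_relation
    {k : Type*} [Field k] {p n : ℕ} (m c : ℕ)
    (ν : ZMod 3 → Fin n) (α : Fin 3 → Fin n)
    (hνα : Function.Injective (Sum.elim ν α))
    (β : Fin m → Fin 2 → Fin n) (hβ : Function.Injective β)
    (γ : Fin c → Fin n) (hγ : Function.Injective γ)
    (hmc : 3 + (m + c) = p)
    (ω : ⋀[k]^p (Fin n → k)) :
    (∑ i : ZMod 3,
        Pprime k (m + 1) c ![ν i, α 0, α 1, α 2]
          (Fin.snoc β ![ν (i + 1), ν (i + 2)]) γ ω.val)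
      - ∑ i : ZMod 3, ∑ j : ZMod 3,
          (if i = j then 0 else
            Pprime k m (c + 1) ![ν i, α 0, α 1, α 2] β (Fin.snoc γ (ν j)) ω.val) = 0 := by
  obtain ⟨s, hs, h⟩ := exists_sign_piF_snoc k n m c
  have hB (a : Fin 4 → Fin n) (u v : Fin n) :
      Pprime k (m + 1) c a (Fin.snoc β ![u, v]) γ ω.val =
        (tripleF k β γ (a 0) (a 1) u ω.val + tripleF k β γ (a 0) (a 1) v ω.val) *
            (tripleF k β γ (a 2) (a 3) u ω.val + tripleF k β γ (a 2) (a 3) v ω.val)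
          - (tripleF k β γ (a 0) (a 2) u ω.val + tripleF k β γ (a 0) (a 2) v ω.val) *
            (tripleF k β γ (a 1) (a 3) u ω.val + tripleF k β γ (a 1) (a 3) v ω.val)
          + (tripleF k β γ (a 0) (a 3) u ω.val + tripleF k β γ (a 0) (a 3) v ω.val) *
            (tripleF k β γ (a 1) (a 2) u ω.val + tripleF k β γ (a 1) (a 2) v ω.val) := by
    simp only [Pprime, h, LinearMap.smul_apply, LinearMap.add_apply, smul_eq_mul,
      mul_mul_mul_comm s, hs, one_mul]
  have hC (a : Fin 4 → Fin n) (u : Fin n) :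
      Pprime k m (c + 1) a β (Fin.snoc γ u) ω.val =
        tripleF k β γ (a 0) (a 1) u ω.val * tripleF k β γ (a 2) (a 3) u ω.val
          - tripleF k β γ (a 0) (a 2) u ω.val * tripleF k β γ (a 1) (a 3) u ω.val
          + tripleF k β γ (a 0) (a 3) u ω.val * tripleF k β γ (a 1) (a 2) u ω.val := rfl
  have hsum (f : ZMod 3 → k) : ∑ i, f i = f 0 + f 1 + f 2 := Fin.sum_univ_three f
  have hswap (x y z : Fin n) : tripleF k β γ z y x ω.val = -tripleF k β γ x y z ω.val := by
    rw [tripleF_swap, LinearMap.neg_apply]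
  have h01 (t : Fin 3) := hswap (ν 0) (α t) (ν 1)
  have h12 (t : Fin 3) := hswap (ν 1) (α t) (ν 2)
  have h02 (t : Fin 3) := hswap (ν 0) (α t) (ν 2)
  have e11 : (1 : ZMod 3) + 1 = 2 := rfl
  have e12 : (1 : ZMod 3) + 2 = 0 := rfl
  have e21 : (2 : ZMod 3) + 1 = 0 := rfl
  have e22 : (2 : ZMod 3) + 2 = 1 := rfl
  have n01 : (0 : ZMod 3) ≠ 1 := by decide
  have n02 : (0 : ZMod 3) ≠ 2 := by decide
  have n12 : (1 : ZMod 3) ≠ 2 := by decide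
  simp only [hsum, hB, hC, zero_add, e11, e12, e21, e22, n01, n02, n12, n01.symm, n02.symm,
    n12.symm, if_true, if_false]
  simp only [Matrix.cons_val, h01, h12, h02]
  ring

end
end
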